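/- arXiv:2302.12351 — 4 statements merged into one kernel-verified Lean document; each statement's English description precedes it below -/
import Mathlib

section
/- The empirical Rademacher complexity of the product class satisfies R(f∘HΔH) ≤ (W²/n) · ( √( 2 · ‖Σ_{i=1}^n (x_i x_iᵀ)²‖_2 · log(2d) ) + (‖X‖²_{2,∞} · log(2d))/3 ) · κ, where κ = 1 if 1 ≤ p ≤ 2 and κ = d^{1−2/p} if p > 2. -/
open scoped BigOperators

noncomputable def supNorm {d : ℕ} (v : Fin d → ℝ) : ℝ := ⨆ i, |v i|

noncomputable def pNorm {d : ℕ} (p : ℝ) (v : Fin d → ℝ) : ℝ := (∑ i, |v i| ^ p) ^ (1 / p)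

noncomputable def twoNorm {d : ℕ} (v : Fin d → ℝ) : ℝ := Real.sqrt (∑ i, (v i) ^ 2)

def ip {d : ℕ} (w x : Fin d → ℝ) : ℝ := ∑ i, w i * x i

noncomputable def outer {d : ℕ} (v : Fin d → ℝ) : Matrix (Fin d) (Fin d) ℝ :=
  Matrix.of fun a b => v a * v b

noncomputable def specNorm {d : ℕ} (A : Matrix (Fin d) (Fin d) ℝ) : ℝ :=
  sSup {y : ℝ | ∃ v : Fin d → ℝ, twoNorm v ≤ 1 ∧ y = twoNorm (A.mulVec v)}

noncomputable def Esign (n : ℕ) (f : (Fin n → ℝ) → ℝ) : ℝ :=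
  (∑ s : Fin n → Bool, f fun i => if s i then (1 : ℝ) else -1) / 2 ^ n

section Aux
open Matrix
lemma spec {d : ℕ} (A : Matrix (Fin d) (Fin d) ℝ) (hA : A.IsHermitian) :
  ∃ (l : Fin d → ℝ) (u : Fin d → Fin d → ℝ), (∀ k, u k ⬝ᵥ u k = 1) ∧
   (∀ (q : ℕ) w w', w ⬝ᵥ (A^q *ᵥ w') = ∑ k, l k^q * ((u k ⬝ᵥ w)*(u k ⬝ᵥ w'))) ∧
   ∀ q : ℕ, trace (A^q) = ∑ k, l k^q := by
  set U : Matrix (Fin d) (Fin d) ℝ := (hA.eigenvectorUnitary).1 with hU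
  set l := hA.eigenvalues with hl
  have h1 : Uᵀ * U = 1 := by
    have := Unitary.star_mul_self_of_mem (hA.eigenvectorUnitary).2
    simpa [star_eq_conjTranspose] using this
  have hs : A = U * diagonal l * Uᵀ := by
    have := hA.spectral_theorem
    rw [Unitary.conjStarAlgAut_apply] at this
    simpa [star_eq_conjTranspose, Function.comp_def] using this
  have hpow : ∀ q : ℕ, A ^ q = U * diagonal (fun k => l k ^ q) * Uᵀ := by
    intro q
    induction q with
    | zero => simp [mul_eq_one_comm.mp h1]
    | succ q ih =>
      rw [pow_succ, ih]
      nth_rw 1 [hs]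
      calc U * diagonal (fun k => l k ^ q) * Uᵀ * (U * diagonal l * Uᵀ) 
          = U * (diagonal (fun k => l k ^ q) * (Uᵀ * U) * diagonal l) * Uᵀ := by
            simp only [Matrix.mul_assoc]
        _ = _ := by rw [h1]; simp [pow_succ]
  refine ⟨l, Uᵀ, fun k => ?_, fun q w w' => ?_, fun q => ?_⟩
  · have := congrFun (congrFun h1 k) k
    simpa [Matrix.mul_apply, dotProduct] using this
  · rw [hpow, ← mulVec_mulVec, ← mulVec_mulVec, dotProduct_mulVec, ← mulVec_transpose]
    simp only [dotProduct, mulVec_diagonal]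
    refine Finset.sum_congr rfl fun k _ => ?_
    simp only [mulVec, dotProduct]
    ring
  · rw [hpow, trace_mul_comm, ← Matrix.mul_assoc, h1]
    simp [trace]

lemma powdiff {R : Type*} [Ring R] (X Y : R) (m : ℕ) :
   X^(m+1) - Y^(m+1) = ∑ q ∈ Finset.range (m+1), X^q * (X - Y) * Y^(m-q) := by
  induction m with
  | zero => simp
  | succ m ih =>
    rw [Finset.sum_range_succ']
    have : ∀ q ∈ Finset.range (m+1), X^(q+1) * (X - Y) * Y^(m+1-(q+1)) = X * (X^q * (X - Y) * Y^(m-q)) := by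
      intro q _
      rw [pow_succ']; simp [mul_assoc]
    rw [Finset.sum_congr rfl this, ← Finset.mul_sum, ← ih]
    rw [pow_succ' X (m+1), pow_succ' Y (m+1)]
    simp; noncomm_ring

lemma amgm (a b : ℝ) (r q : ℕ) (hq : q ≤ 2*r) :
   a^q*b^(2*r-q) + b^q*a^(2*r-q) ≤ a^(2*r) + b^(2*r) := by
  have key : ∀ a b : ℝ, 0 ≤ a → 0 ≤ b → a^q*b^(2*r-q) + b^q*a^(2*r-q) ≤ a^(2*r) + b^(2*r) := by
    intro a b ha hb
    have e1 : a^(2*r) = a^q * a^(2*r-q) := by rw [← pow_add]; congr 1; omega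
    have e2 : b^(2*r) = b^q * b^(2*r-q) := by rw [← pow_add]; congr 1; omega
    rw [e1, e2]
    rcases le_total a b with h | h
    · have h1 := pow_le_pow_left₀ ha h q
      have h2 := pow_le_pow_left₀ ha h (2*r-q)
      nlinarith
    · have h1 := pow_le_pow_left₀ hb h q
      have h2 := pow_le_pow_left₀ hb h (2*r-q)
      nlinarith
  have := key |a| |b| (abs_nonneg _) (abs_nonneg _)
  have ev : Even (2*r) := even_two_mul r
  rw [ev.pow_abs, ev.pow_abs] at this
  refine le_trans (add_le_add ?_ ?_) this
  · rw [← abs_pow, ← abs_pow, ← abs_mul]; exact le_abs_self _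
  · rw [← abs_pow, ← abs_pow, ← abs_mul]; exact le_abs_self _

lemma momineq {d : ℕ} (X Y : Matrix (Fin d) (Fin d) ℝ) (hX : X.IsHermitian) (hY : Y.IsHermitian)
   (x : Fin d → ℝ) (r q : ℕ) (hq : q ≤ 2*r) :
   (x ⬝ᵥ (X^q *ᵥ x)) * (x ⬝ᵥ (Y^(2*r-q) *ᵥ x)) + (x ⬝ᵥ (Y^q *ᵥ x)) * (x ⬝ᵥ (X^(2*r-q) *ᵥ x))
   ≤ (x ⬝ᵥ x) * (x ⬝ᵥ (X^(2*r) *ᵥ x) + x ⬝ᵥ (Y^(2*r) *ᵥ x)) := by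
  obtain ⟨l, u, -, h, -⟩ := spec X hX
  obtain ⟨m, v, -, g, -⟩ := spec Y hY
  have h0 := h 0 x x
  have g0 := g 0 x x
  simp only [pow_zero, one_mulVec, one_mul] at h0 g0
  rw [mul_add]
  nth_rw 1 [g0]
  rw [h0]
  simp only [h, g, Finset.sum_mul_sum]
  have sw : ∀ F : Fin d → Fin d → ℝ, ∑ i, ∑ j, F i j = ∑ j, ∑ i, F i j := fun F => Finset.sum_comm
  rw [sw (fun i j => m i ^ q * _ * _), sw (fun i j => (v i ⬝ᵥ x * _) * _)]
  simp only [← Finset.sum_add_distrib]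
  refine Finset.sum_le_sum fun i _ => Finset.sum_le_sum fun j _ => ?_
  have := mul_le_mul_of_nonneg_left (amgm (l i) (m j) r q hq) (mul_nonneg (mul_self_nonneg (u i ⬝ᵥ x)) (mul_self_nonneg (v j ⬝ᵥ x)))
  linarith

noncomputable def sgn {n : ℕ} (s : Fin n → Bool) (i : Fin n) : ℝ := if s i then (1 : ℝ) else -1

lemma sgn_sq {n : ℕ} (s : Fin n → Bool) (i : Fin n) : sgn s i * sgn s i = 1 := by
  unfold sgn; split_ifs <;> simp

def flp {n : ℕ} (i : Fin n) (s : Fin n → Bool) : Fin n → Bool := Function.update s i (!s i)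

lemma flp_inv {n : ℕ} (i : Fin n) : Function.Involutive (flp i) := by
  intro s; unfold flp; simp

lemma sum_flp {n : ℕ} (i : Fin n) (f : (Fin n → Bool) → ℝ) : ∑ s, f (flp i s) = ∑ s, f s :=
  Equiv.sum_comp (flp_inv i).toPerm f

lemma sgn_flp {n : ℕ} (i : Fin n) (s : Fin n → Bool) : sgn (flp i s) i = - sgn s i := by
  unfold sgn flp; cases h : s i <;> simp [h]

lemma sgn_flp_ne {n : ℕ} (i j : Fin n) (h : j ≠ i) (s : Fin n → Bool) : sgn (flp i s) j = sgn s j := by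
  unfold sgn flp; simp [h]

noncomputable def XX {d n : ℕ} (x : Fin n → Fin d → ℝ) (s : Fin n → Bool) : Matrix (Fin d) (Fin d) ℝ :=
  ∑ i, sgn s i • outer (x i)

lemma outer_eq {d : ℕ} (v : Fin d → ℝ) : outer v = vecMulVec v v := rfl

lemma XX_herm {d n : ℕ} (x : Fin n → Fin d → ℝ) (s : Fin n → Bool) : (XX x s).IsHermitian := by
  unfold XX Matrix.IsHermitian
  ext a b
  simp [Matrix.sum_apply, outer, mul_comm]

lemma XX_flp {d n : ℕ} (x : Fin n → Fin d → ℝ) (i : Fin n) (s : Fin n → Bool) :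
    XX x s - XX x (flp i s) = (2 * sgn s i) • outer (x i) := by
  unfold XX
  rw [← Finset.sum_sub_distrib, Finset.sum_eq_single i]
  · rw [sgn_flp, ← sub_smul]; congr 1; ring
  · intro j _ hj; rw [sgn_flp_ne i j hj, sub_self]
  · simp

lemma quad_outer {d : ℕ} (x w w' : Fin d → ℝ) (P Q : Matrix (Fin d) (Fin d) ℝ) :
    w ⬝ᵥ ((P * outer x * Q) *ᵥ w') = (w ⬝ᵥ (P *ᵥ x)) * (x ⬝ᵥ (Q *ᵥ w')) := by
  rw [outer_eq, ← mulVec_mulVec, ← mulVec_mulVec, vecMulVec_mulVec]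
  simp [mulVec_smul]
  ring

lemma trace_outer {d : ℕ} (x : Fin d → ℝ) (M : Matrix (Fin d) (Fin d) ℝ) :
    trace (outer x * M) = x ⬝ᵥ (M *ᵥ x) := by
  rw [outer_eq, Matrix.trace_mul_comm, Matrix.mul_vecMulVec, Matrix.trace_vecMulVec, dotProduct_comm]

lemma step {d n : ℕ} (x : Fin n → Fin d → ℝ) (i : Fin n) (r : ℕ) :
    ∑ s, sgn s i * (x i ⬝ᵥ (XX x s ^ (2*r+1) *ᵥ x i)) ≤
      (2*r+1) * ∑ s, (x i ⬝ᵥ x i) * (x i ⬝ᵥ (XX x s ^ (2*r) *ᵥ x i)) := by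
  set m : (Fin n → Bool) → ℕ → ℝ := fun s q => x i ⬝ᵥ (XX x s ^ q *ᵥ x i) with hm
  have h1 : ∀ s, sgn s i * (m s (2*r+1) - m (flp i s) (2*r+1)) =
      2 * ∑ q ∈ Finset.range (2*r+1), m s q * m (flp i s) (2*r-q) := by
    intro s
    simp only [hm]
    rw [← dotProduct_sub, ← sub_mulVec, powdiff, XX_flp, Matrix.sum_mulVec, dotProduct_sum,
      Finset.mul_sum, Finset.mul_sum]
    refine Finset.sum_congr rfl fun q _ => ?_
    rw [Matrix.mul_smul, Matrix.smul_mul, smul_mulVec, dotProduct_smul, quad_outer, smul_eq_mul]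
    linear_combination 2 * ((x i ⬝ᵥ XX x s ^ q *ᵥ x i) * (x i ⬝ᵥ XX x (flp i s) ^ (2 * r - q) *ᵥ x i)) * sgn_sq s i
  have h2 : ∑ s, sgn s i * m s (2*r+1) = ∑ s, ∑ q ∈ Finset.range (2*r+1), m s q * m (flp i s) (2*r-q) := by
    have e := sum_flp i (fun s => sgn s i * m s (2*r+1))
    have e2 : ∑ s, sgn s i * (m s (2*r+1) - m (flp i s) (2*r+1)) = 2 * ∑ s, sgn s i * m s (2*r+1) := by
      rw [two_mul (∑ s, _)]
      nth_rw 2 [← e]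
      rw [← Finset.sum_add_distrib]
      refine Finset.sum_congr rfl fun s _ => ?_
      simp only [sgn_flp]; ring
    simp only [h1, ← Finset.mul_sum] at e2
    linarith
  have h3 : ∀ q ∈ Finset.range (2*r+1), ∑ s, m s q * m (flp i s) (2*r-q) ≤
      ∑ s, (x i ⬝ᵥ x i) * m s (2*r) := by
    intro q hq
    have hq' : q ≤ 2*r := by simpa [Nat.lt_succ_iff] using hq
    have e := sum_flp i (fun s => m s q * m (flp i s) (2*r-q))
    have e2 := sum_flp i (fun s => (x i ⬝ᵥ x i) * m s (2*r))
    have : ∑ s, (m s q * m (flp i s) (2*r-q) + m (flp i s) q * m s (2*r-q)) ≤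
        ∑ s, (x i ⬝ᵥ x i) * (m s (2*r) + m (flp i s) (2*r)) :=
      Finset.sum_le_sum fun s _ => momineq _ _ (XX_herm x s) (XX_herm x (flp i s)) (x i) r q hq'
    simp only [mul_add, Finset.sum_add_distrib] at this
    simp only [flp_inv i _] at e
    linarith
  change ∑ s, sgn s i * m s (2*r+1) ≤ (2*r+1) * ∑ s, (x i ⬝ᵥ x i) * m s (2*r)
  rw [h2, Finset.sum_comm]
  refine (Finset.sum_le_sum h3).trans ?_
  simp

lemma twoNorm_eq {d : ℕ} (v : Fin d → ℝ) : twoNorm v = Real.sqrt (v ⬝ᵥ v) := by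
  simp [twoNorm, dotProduct, sq]

lemma cs {d : ℕ} (u v : Fin d → ℝ) : u ⬝ᵥ v ≤ twoNorm u * twoNorm v := by
  unfold twoNorm dotProduct
  exact Real.sum_mul_le_sqrt_mul_sqrt _ _ _

lemma spec_bdd {d : ℕ} (A : Matrix (Fin d) (Fin d) ℝ) :
    BddAbove {y : ℝ | ∃ v : Fin d → ℝ, twoNorm v ≤ 1 ∧ y = twoNorm (A.mulVec v)} := by
  refine ⟨Real.sqrt (∑ a, ∑ b, A a b ^ 2), ?_⟩
  rintro y ⟨v, hv, rfl⟩
  unfold twoNorm at hv ⊢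
  apply Real.sqrt_le_sqrt
  refine Finset.sum_le_sum fun a _ => ?_
  have h := Finset.sum_mul_sq_le_sq_mul_sq Finset.univ (A a) v
  have h1 : ∑ i, v i ^ 2 ≤ 1 := by simpa using hv
  have h0 : 0 ≤ ∑ b, A a b ^ 2 := Finset.sum_nonneg fun _ _ => sq_nonneg _
  simp only [mulVec, dotProduct]
  nlinarith

lemma le_spec {d : ℕ} (A : Matrix (Fin d) (Fin d) ℝ) (u : Fin d → ℝ) (hu : u ⬝ᵥ u = 1) :
    u ⬝ᵥ (A *ᵥ u) ≤ specNorm A := by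
  have h1 : twoNorm u = 1 := by rw [twoNorm_eq, hu, Real.sqrt_one]
  have := cs u (A *ᵥ u)
  rw [h1, one_mul] at this
  exact this.trans (le_csSup (spec_bdd A) ⟨u, h1.le, rfl⟩)

lemma spec_nonneg {d : ℕ} (A : Matrix (Fin d) (Fin d) ℝ) : 0 ≤ specNorm A := by
  apply Real.sSup_nonneg
  rintro y ⟨v, -, rfl⟩
  exact Real.sqrt_nonneg _

noncomputable def VV {d n : ℕ} (x : Fin n → Fin d → ℝ) : Matrix (Fin d) (Fin d) ℝ :=
  ∑ i, outer (x i) * outer (x i)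

lemma VV_quad {d n : ℕ} (x : Fin n → Fin d → ℝ) (u : Fin d → ℝ) :
    u ⬝ᵥ (VV x *ᵥ u) = ∑ i, (x i ⬝ᵥ x i) * ((u ⬝ᵥ x i) * (u ⬝ᵥ x i)) := by
  unfold VV
  rw [Matrix.sum_mulVec, dotProduct_sum]
  refine Finset.sum_congr rfl fun i _ => ?_
  have := quad_outer (x i) u u 1 (outer (x i))
  rw [one_mul] at this
  rw [this, outer_eq, vecMulVec_mulVec]
  simp [dotProduct_comm (x i) u]
  ring

lemma step2 {d n : ℕ} (x : Fin n → Fin d → ℝ) (s : Fin n → Bool) (r : ℕ) :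
    ∑ i, (x i ⬝ᵥ x i) * (x i ⬝ᵥ (XX x s ^ (2*r) *ᵥ x i)) ≤ specNorm (VV x) * trace (XX x s ^ (2*r)) := by
  obtain ⟨l, u, h1, h2, h3⟩ := spec _ (XX_herm x s)
  simp only [h2, h3, Finset.mul_sum]
  rw [Finset.sum_comm]
  refine Finset.sum_le_sum fun k _ => ?_
  have h := le_spec (VV x) (u k) (h1 k)
  rw [VV_quad] at h
  have hl : 0 ≤ l k ^ (2*r) := (even_two_mul r).pow_nonneg _
  refine le_trans (le_of_eq ?_) (mul_le_mul_of_nonneg_right h hl)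
  rw [Finset.sum_mul]
  refine Finset.sum_congr rfl fun i _ => ?_
  ring

lemma trace_succ {d n : ℕ} (x : Fin n → Fin d → ℝ) (s : Fin n → Bool) (m : ℕ) :
    trace (XX x s ^ (m+1)) = ∑ i, sgn s i * (x i ⬝ᵥ (XX x s ^ m *ᵥ x i)) := by
  rw [pow_succ']
  nth_rw 1 [XX]
  rw [Finset.sum_mul, trace_sum]
  refine Finset.sum_congr rfl fun i _ => ?_
  rw [smul_mul_assoc, trace_smul, trace_outer, smul_eq_mul]

lemma moment_step {d n : ℕ} (x : Fin n → Fin d → ℝ) (r : ℕ) :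
    ∑ s, trace (XX x s ^ (2*(r+1))) ≤ (2*r+1) * (specNorm (VV x) * ∑ s, trace (XX x s ^ (2*r))) := by
  have e : 2*(r+1) = (2*r+1)+1 := by ring
  simp only [e, trace_succ x _ (2*r+1)]
  rw [Finset.sum_comm]
  refine (Finset.sum_le_sum fun i _ => step x i r).trans ?_
  rw [← Finset.mul_sum, Finset.sum_comm]
  refine mul_le_mul_of_nonneg_left ?_ (by positivity)
  rw [Finset.mul_sum]
  exact Finset.sum_le_sum fun s _ => step2 x s r

lemma moment {d n : ℕ} (x : Fin n → Fin d → ℝ) (r : ℕ) :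
    (∑ s, trace (XX x s ^ (2*r))) / ((2*r).factorial : ℝ) ≤
      2^n * d * ((specNorm (VV x) / 2) ^ r / (r.factorial : ℝ)) := by
  induction r with
  | zero => simp
  | succ r ih =>
    have h := moment_step x r
    have hv := spec_nonneg (VV x)
    set v := specNorm (VV x)
    have e : ((2*(r+1)).factorial : ℝ) = (2*r+2) * ((2*r+1) * (2*r).factorial) := by
      rw [show 2*(r+1) = (2*r+1)+1 by ring, Nat.factorial_succ, Nat.factorial_succ]; push_cast; ring
    have hf : (0:ℝ) < (2*r).factorial := by positivity
    have hf' : (0:ℝ) < (r).factorial := by positivity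
    rw [e, Nat.factorial_succ]
    calc _ ≤ ((2*r+1) * (v * ∑ s, trace (XX x s ^ (2*r)))) / ((2*r+2) * ((2*r+1) * (2*r).factorial)) := by
          gcongr
      _ = v / (2*r+2) * ((∑ s, trace (XX x s ^ (2*r))) / ((2*r).factorial : ℝ)) := by
          field_simp
      _ ≤ v / (2*r+2) * (2^n * d * ((v / 2) ^ r / (r.factorial : ℝ))) := by gcongr
      _ = _ := by push_cast; rw [pow_succ]; field_simp

lemma exists_M {d n : ℕ} (x : Fin n → Fin d → ℝ) (hd : 1 ≤ d) (s : Fin n → Bool) :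
    ∃ M : ℝ, 0 ≤ M ∧ (∀ r : ℕ, M ^ (2*r) ≤ trace (XX x s ^ (2*r))) ∧
      ∀ w w' : Fin d → ℝ, w ⬝ᵥ (XX x s *ᵥ w') ≤ M * (twoNorm w * twoNorm w') := by
  obtain ⟨l, u, h1, h2, h3⟩ := spec _ (XX_herm x s)
  haveI : Nonempty (Fin d) := ⟨⟨0, hd⟩⟩
  obtain ⟨k, hk⟩ := Finite.exists_max (fun k => |l k|)
  refine ⟨|l k|, abs_nonneg _, fun r => ?_, fun w w' => ?_⟩
  · rw [h3, (even_two_mul r).pow_abs]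
    exact Finset.single_le_sum (f := fun k => l k ^ (2*r)) (fun i _ => (even_two_mul r).pow_nonneg _) (Finset.mem_univ k)
  · have h := h2 1 w w'
    rw [pow_one] at h
    have hn : ∀ w : Fin d → ℝ, twoNorm w = Real.sqrt (∑ j, |u j ⬝ᵥ w| ^ 2) := by
      intro w
      have := h2 0 w w
      simp only [pow_zero, one_mulVec, one_mul] at this
      rw [twoNorm_eq, this]
      simp [sq]
    rw [h, hn w, hn w']
    refine le_trans ?_ (mul_le_mul_of_nonneg_left (Real.sum_mul_le_sqrt_mul_sqrt Finset.univ _ _) (abs_nonneg _))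
    rw [Finset.mul_sum]
    refine Finset.sum_le_sum fun j _ => ?_
    refine (le_abs_self _).trans ?_
    rw [pow_one, abs_mul, abs_mul]
    exact mul_le_mul_of_nonneg_right (hk j) (by positivity)

lemma mean_bound {d n : ℕ} (x : Fin n → Fin d → ℝ) (hd : 1 ≤ d) (M : (Fin n → Bool) → ℝ)
    (h0 : ∀ s, 0 ≤ M s) (hM : ∀ s (r : ℕ), M s ^ (2*r) ≤ trace (XX x s ^ (2*r))) :
    (∑ s, M s) / 2^n ≤ Real.sqrt (2 * specNorm (VV x) * Real.log (2 * (d : ℝ))) := by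
  have hv := spec_nonneg (VV x)
  set v := specNorm (VV x) with hvdef
  set m := (∑ s, M s) / 2^n with hm
  have hm0 : 0 ≤ m := div_nonneg (Finset.sum_nonneg fun s _ => h0 s) (by positivity)
  have hd' : (1:ℝ) ≤ d := by exact_mod_cast hd
  have hsum : ∑ s, M s = 2^n * m := by rw [hm]; field_simp
  have hcosh : ∀ t : ℝ, ∑ s, Real.cosh (t * M s) ≤ 2^n * d * Real.exp (t^2 * v / 2) := by
    intro t
    have a := hasSum_sum (s := Finset.univ) (fun s (_ : s ∈ Finset.univ) => Real.hasSum_cosh (t * M s))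
    have b := (NormedSpace.expSeries_div_hasSum_exp (t^2 * v / 2)).mul_left ((2:ℝ)^n * d)
    rw [← Real.exp_eq_exp_ℝ] at b
    refine hasSum_le (fun r => ?_) a b
    have h1 := moment x r
    have ht : 0 ≤ t^(2*r) := (even_two_mul r).pow_nonneg _
    calc ∑ s, (t * M s)^(2*r) / ((2*r).factorial : ℝ) = t^(2*r) * ((∑ s, M s ^ (2*r)) / ((2*r).factorial : ℝ)) := by
          rw [← Finset.sum_div, ← mul_div_assoc, Finset.mul_sum]
          simp only [mul_pow]
      _ ≤ t^(2*r) * ((∑ s, trace (XX x s ^ (2*r))) / ((2*r).factorial : ℝ)) := by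
          gcongr with s _
          exact hM s r
      _ ≤ t^(2*r) * (2^n * d * ((v / 2) ^ r / (r.factorial : ℝ))) := by gcongr
      _ = _ := by
          rw [mul_div_assoc (t^2) v 2, mul_pow (t^2), ← pow_mul]; ring
  have key : ∀ t : ℝ, t * m ≤ Real.log (2*d) + t^2 * v / 2 := by
    intro t
    have h1 : 2^n * Real.exp (t * m) ≤ ∑ s, Real.exp (t * M s) := by
      have : ∀ s, Real.exp (t*m) * (t * M s - t * m + 1) ≤ Real.exp (t * M s) := by
        intro s
        have := mul_le_mul_of_nonneg_left (Real.add_one_le_exp (t * M s - t * m)) (Real.exp_pos (t*m)).le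
        rwa [← Real.exp_add, add_sub_cancel] at this
      refine le_trans (le_of_eq ?_) (Finset.sum_le_sum fun s _ => this s)
      rw [← Finset.mul_sum, Finset.sum_add_distrib, Finset.sum_sub_distrib, ← Finset.mul_sum, hsum]
      simp
      ring
    have h2 : ∑ s, Real.exp (t * M s) ≤ 2 * ∑ s, Real.cosh (t * M s) := by
      rw [Finset.mul_sum]
      refine Finset.sum_le_sum fun s _ => ?_
      rw [Real.cosh_eq]
      have := Real.exp_pos (-(t * M s))
      linarith
    have h3 : (2:ℝ)^n * Real.exp (t * m) ≤ 2^n * (2 * d * Real.exp (t^2 * v / 2)) := by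
      have := hcosh t
      linarith
    have h4 := le_of_mul_le_mul_left h3 (by positivity)
    rw [← Real.exp_log (show (0:ℝ) < 2 * d by positivity), ← Real.exp_add] at h4
    exact Real.exp_le_exp.mp h4
  have hL : 0 ≤ Real.log (2*d) := Real.log_nonneg (by linarith)
  apply Real.le_sqrt_of_sq_le
  set L := Real.log (2*d)
  rcases hv.eq_or_lt with hv0 | hv0
  · rw [← hv0] at key ⊢
    have := key (L + 1)
    have h2 := key (2 * (L+1) * m)
    rcases hm0.eq_or_lt with hm1 | hm1
    · rw [← hm1]; simp
    · have := key ((L+1)/m)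
      rw [div_mul_cancel₀ _ hm1.ne'] at this
      linarith
  · have := key (m / v)
    have e : m / v * m = m^2 / v := by ring
    have e2 : (m/v)^2 * v / 2 = m^2 / v / 2 := by field_simp
    rw [e, e2] at this
    have : m^2 / v ≤ 2 * L := by linarith
    rw [div_le_iff₀ hv0] at this
    linarith

lemma pnorm_bound {d : ℕ} (hd : 1 ≤ d) (p W : ℝ) (hp : 1 ≤ p) (hW : 0 < W) (w : Fin d → ℝ)
    (h : pNorm p w ≤ W) :
    twoNorm w ^ 2 ≤ W^2 * (if p ≤ 2 then 1 else (d : ℝ) ^ (1 - 2 / p)) := by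
  have hp0 : 0 < p := by linarith
  have hS : 0 ≤ ∑ i, |w i| ^ p := Finset.sum_nonneg fun i _ => by positivity
  have hsum : ∑ i, |w i| ^ p ≤ W ^ p := by
    have := Real.rpow_le_rpow (by unfold pNorm; positivity) h hp0.le
    unfold pNorm at this
    rwa [← Real.rpow_mul hS, one_div_mul_cancel hp0.ne', Real.rpow_one] at this
  have e : twoNorm w ^ 2 = ∑ i, w i ^ 2 := by
    unfold twoNorm; rw [Real.sq_sqrt (Finset.sum_nonneg fun i _ => sq_nonneg _)]
  rw [e]
  split_ifs with hp2
  · have hi : ∀ i, |w i| ≤ W := by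
      intro i
      have h1 : |w i| ^ p ≤ W ^ p := le_trans
        (Finset.single_le_sum (f := fun i => |w i| ^ p) (fun i _ => by positivity) (Finset.mem_univ i)) hsum
      exact (Real.rpow_le_rpow_iff (abs_nonneg _) hW.le hp0).mp h1
    have h2 : ∀ i, w i ^ 2 ≤ |w i| ^ p * W ^ (2 - p) := by
      intro i
      have : |w i| ^ (2:ℝ) = |w i| ^ p * |w i| ^ (2 - p) := by
        rw [← Real.rpow_add_of_nonneg (abs_nonneg _) hp0.le (by linarith)]; congr 1; ring
      rw [← sq_abs, ← Real.rpow_two, this]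
      exact mul_le_mul_of_nonneg_left (Real.rpow_le_rpow (abs_nonneg _) (hi i) (by linarith)) (by positivity)
    refine (Finset.sum_le_sum fun i _ => h2 i).trans ?_
    rw [← Finset.sum_mul]
    refine (mul_le_mul_of_nonneg_right hsum (by positivity)).trans ?_
    rw [← Real.rpow_add hW, mul_one, ← Real.rpow_two]
    simp
  · push Not at hp2
    have hd0 : (0:ℝ) < d := by exact_mod_cast hd
    have h1 := Real.rpow_sum_le_const_mul_sum_rpow Finset.univ (fun i => w i ^ 2) (p := p/2) (by linarith)
    have h3 : ∀ i, |w i ^ 2| ^ (p/2) = |w i| ^ p := by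
      intro i
      rw [abs_pow, ← Real.rpow_two, ← Real.rpow_mul (abs_nonneg _)]; congr 1; ring
    simp only [h3] at h1
    simp only [abs_pow, sq_abs, Finset.card_univ, Fintype.card_fin] at h1
    have h4 : (∑ i, w i ^ 2) ^ (p/2) ≤ (W^2 * (d : ℝ) ^ (1 - 2 / p)) ^ (p/2) := by
      refine h1.trans ((mul_le_mul_of_nonneg_left hsum (by positivity)).trans (le_of_eq ?_))
      rw [Real.mul_rpow (by positivity) (by positivity), ← Real.rpow_two, ← Real.rpow_mul hW.le,
        ← Real.rpow_mul hd0.le, mul_comm]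
      congr 2
      · ring
      · field_simp
    exact (Real.rpow_le_rpow_iff (Finset.sum_nonneg fun i _ => sq_nonneg _) (by positivity) (by linarith)).mp h4

lemma quad_XX {d n : ℕ} (x : Fin n → Fin d → ℝ) (s : Fin n → Bool) (w w' : Fin d → ℝ) :
    ∑ i, (if s i then (1:ℝ) else -1) * (ip w (x i) * ip w' (x i)) = w ⬝ᵥ (XX x s *ᵥ w') := by
  unfold XX
  rw [Matrix.sum_mulVec, dotProduct_sum]
  refine Finset.sum_congr rfl fun i _ => ?_
  have := quad_outer (x i) w w' 1 1
  rw [one_mul, mul_one, one_mulVec, one_mulVec, dotProduct_comm (x i) w'] at this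
  rw [smul_mulVec, dotProduct_smul, this]
  rfl

end Aux

open Matrix in
lemma aux_main {d n : ℕ} (hd : 1 ≤ d) (hn : 1 ≤ n) (p W : ℝ) (hp : 1 ≤ p) (hW : 0 < W)
    (x : Fin n → Fin d → ℝ) :
    Esign n (fun σ => sSup {r : ℝ | ∃ w w' : Fin d → ℝ,
        pNorm p w ≤ W ∧ pNorm p w' ≤ W ∧
        r = (1 / (n : ℝ)) * ∑ i, σ i * (ip w (x i) * ip w' (x i))}) ≤
      W ^ 2 / (n : ℝ) *
        (Real.sqrt (2 * specNorm (∑ i, outer (x i) * outer (x i)) * Real.log (2 * (d : ℝ))) +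
          (⨆ i, twoNorm (x i)) ^ 2 * Real.log (2 * (d : ℝ)) / 3) *
        (if p ≤ 2 then 1 else (d : ℝ) ^ (1 - 2 / p)) := by
  classical
  choose M hM0 hM1 hM2 using exists_M x hd
  have hmean := mean_bound x hd M hM0 hM1
  set κ : ℝ := if p ≤ 2 then 1 else (d : ℝ) ^ (1 - 2 / p) with hκ
  have hκ0 : 0 ≤ κ := by rw [hκ]; split_ifs <;> positivity
  have hn0 : (0:ℝ) < n := by exact_mod_cast hn
  have hd' : (1:ℝ) ≤ d := by exact_mod_cast hd
  have hL : 0 ≤ Real.log (2*(d:ℝ)) := Real.log_nonneg (by linarith)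
  have hs : ∀ s : Fin n → Bool, sSup {r : ℝ | ∃ w w' : Fin d → ℝ,
        pNorm p w ≤ W ∧ pNorm p w' ≤ W ∧
        r = (1 / (n : ℝ)) * ∑ i, (if s i then (1 : ℝ) else -1) * (ip w (x i) * ip w' (x i))} ≤
      W^2 / n * κ * M s := by
    intro s
    apply Real.sSup_le
    · rintro r ⟨w, w', hw, hw', rfl⟩
      rw [quad_XX]
      have a := pnorm_bound hd p W hp hW w hw
      have b := pnorm_bound hd p W hp hW w' hw'
      have c : twoNorm w * twoNorm w' ≤ W^2 * κ := by
        nlinarith [sq_nonneg (twoNorm w - twoNorm w')]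
      have e := (hM2 s w w').trans (mul_le_mul_of_nonneg_left c (hM0 s))
      calc 1 / (n:ℝ) * (w ⬝ᵥ (XX x s *ᵥ w')) ≤ 1 / (n:ℝ) * (M s * (W^2 * κ)) := by gcongr
        _ = _ := by ring
    · have := hM0 s
      positivity
  unfold Esign
  calc _ ≤ (∑ s, W^2 / n * κ * M s) / 2^n := by
        gcongr with s _
        exact hs s
    _ = W^2 / n * κ * ((∑ s, M s) / 2^n) := by rw [← Finset.mul_sum, mul_div_assoc]
    _ ≤ W^2 / n * κ * (Real.sqrt (2 * specNorm (VV x) * Real.log (2 * (d : ℝ))) +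
          (⨆ i, twoNorm (x i)) ^ 2 * Real.log (2 * (d : ℝ)) / 3) := by
        apply mul_le_mul_of_nonneg_left _ (by positivity)
        have : 0 ≤ (⨆ i, twoNorm (x i)) ^ 2 * Real.log (2 * (d : ℝ)) / 3 := by positivity
        linarith
    _ = _ := by unfold VV; ring

theorem stmt1 {d n : ℕ} (hd : 1 ≤ d) (hn : 1 ≤ n) (p W : ℝ) (hp : 1 ≤ p) (hW : 0 < W)
    (x : Fin n → Fin d → ℝ) :
    Esign n (fun σ => sSup {r : ℝ | ∃ w w' : Fin d → ℝ,
        pNorm p w ≤ W ∧ pNorm p w' ≤ W ∧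
        r = (1 / (n : ℝ)) * ∑ i, σ i * (ip w (x i) * ip w' (x i))}) ≤
      W ^ 2 / (n : ℝ) *
        (Real.sqrt (2 * specNorm (∑ i, outer (x i) * outer (x i)) * Real.log (2 * (d : ℝ))) +
          (⨆ i, twoNorm (x i)) ^ 2 * Real.log (2 * (d : ℝ)) / 3) *
        (if p ≤ 2 then 1 else (d : ℝ) ^ (1 - 2 / p)) := by
  exact aux_main hd hn p W hp hW x
end

section
/- The adversarial Rademacher complexity of the product class satisfies R(f̃∘HΔH) ≤ R(f∘HΔH) + (2 ε d^{1/p*} W² / √n) · ( 1 + √( d · log(3√n) ) ) · ( ε d^{1/p*} + 2 ‖X‖_{p*,∞} ). -/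
open scoped BigOperators

open MeasureTheory Metric Module in
theorem sep_card {E : Type*} [NormedAddCommGroup E] [NormedSpace ℝ E] [FiniteDimensional ℝ E]
    (s : Finset E) (R r : ℝ) (hR : 0 ≤ R) (hr : 0 < r) (hs : ∀ c ∈ s, ‖c‖ ≤ R)
    (h : ∀ c ∈ s, ∀ d ∈ s, c ≠ d → r ≤ ‖c - d‖) :
    (s.card : ℝ) ≤ (1 + 2 * R / r) ^ finrank ℝ E := by
  borelize E
  let μ : Measure E := Measure.addHaar
  let δ : ℝ := r / 2
  let ρ : ℝ := R + r / 2
  have δpos : 0 < δ := by positivity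
  have ρpos : 0 < ρ := by positivity
  set A := ⋃ c ∈ s, ball (c : E) δ with hA
  have D : Set.Pairwise (s : Set E) (Function.onFun Disjoint fun c => ball (c : E) δ) := by
    rintro c hc d hd hcd
    apply ball_disjoint_ball
    rw [dist_eq_norm]
    have := h c hc d hd hcd
    simp only [δ]; linarith
  have A_subset : A ⊆ ball (0 : E) ρ := by
    refine Set.iUnion₂_subset fun x hx => ?_
    apply ball_subset_ball'
    rw [dist_zero_right]
    have := hs x hx
    simp only [δ, ρ]; linarith
  have I :
    (s.card : ENNReal) * ENNReal.ofReal (δ ^ finrank ℝ E) * μ (ball 0 1) ≤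
      ENNReal.ofReal (ρ ^ finrank ℝ E) * μ (ball 0 1) :=
    calc
      (s.card : ENNReal) * ENNReal.ofReal (δ ^ finrank ℝ E) * μ (ball 0 1) = μ A := by
        rw [hA, measure_biUnion_finset D fun c _ => measurableSet_ball]
        simp only [μ.addHaar_ball_of_pos _ δpos]
        simp only [Finset.sum_const, nsmul_eq_mul, mul_assoc]
      _ ≤ μ (ball (0 : E) ρ) := measure_mono A_subset
      _ = ENNReal.ofReal (ρ ^ finrank ℝ E) * μ (ball 0 1) := by
        simp only [μ.addHaar_ball_of_pos _ ρpos]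
  have J : (s.card : ENNReal) * ENNReal.ofReal (δ ^ finrank ℝ E) ≤ ENNReal.ofReal (ρ ^ finrank ℝ E) :=
    (ENNReal.mul_le_mul_iff_left (measure_ball_pos _ _ zero_lt_one).ne' measure_ball_lt_top.ne).1 I
  have K := ENNReal.toReal_le_of_le_ofReal (pow_nonneg ρpos.le _) J
  rw [ENNReal.toReal_mul, ENNReal.toReal_natCast, ENNReal.toReal_ofReal (by positivity)] at K
  have e : 1 + 2 * R / r = ρ / δ := by simp only [ρ, δ]; field_simp; ring
  rw [e, div_pow, le_div_iff₀ (by positivity)]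
  exact K

theorem exists_net {E : Type*} [NormedAddCommGroup E] [NormedSpace ℝ E] [FiniteDimensional ℝ E]
    (R r : ℝ) (hR : 0 ≤ R) (hr : 0 < r) :
    ∃ C : Finset E, (∀ c ∈ C, ‖c‖ ≤ R) ∧
      (C.card : ℝ) ≤ (1 + 2 * R / r) ^ Module.finrank ℝ E ∧
      ∀ w : E, ‖w‖ ≤ R → ∃ c ∈ C, ‖w - c‖ ≤ r := by
  classical
  let P : ℕ → Prop := fun k => ∃ s : Finset E, s.card = k ∧ (∀ c ∈ s, ‖c‖ ≤ R) ∧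
    (∀ c ∈ s, ∀ d ∈ s, c ≠ d → r ≤ ‖c - d‖)
  have hb : ∀ k, P k → k ≤ ⌊(1 + 2 * R / r) ^ Module.finrank ℝ E⌋₊ := by
    rintro k ⟨s, rfl, h1, h2⟩
    exact Nat.le_floor (sep_card s R r hR hr h1 h2)
  have h0 : P 0 := ⟨∅, by simp⟩
  obtain ⟨s, hs, h1, h2⟩ := Nat.findGreatest_spec (P := P) (hb 0 h0) h0
  refine ⟨s, h1, sep_card s R r hR hr h1 h2, ?_⟩
  intro w hw
  by_contra! hcon
  have hws : w ∉ s := fun hws => by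
    have := hcon w hws
    simp at this; linarith
  have hP : P (s.card + 1) := by
    refine ⟨insert w s, Finset.card_insert_of_notMem hws, ?_, ?_⟩
    · intro c hc
      rcases Finset.mem_insert.1 hc with rfl | hc
      · exact hw
      · exact h1 c hc
    · intro c hc d hd hcd
      rcases Finset.mem_insert.1 hc with rfl | hc <;> rcases Finset.mem_insert.1 hd with rfl | hd
      · exact absurd rfl hcd
      · exact (hcon d hd).le
      · rw [norm_sub_rev]; exact (hcon c (by assumption)).le
      · exact h2 c hc d hd hcd
  have := Nat.le_findGreatest (hb _ hP) hP
  omega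

theorem pnorm_eq {d : ℕ} (p : ℝ) (hp : 1 ≤ p) (v : Fin d → ℝ) :
    ‖WithLp.toLp (ENNReal.ofReal p) v‖ = pNorm p v := by
  have h : (ENNReal.ofReal p).toReal = p := ENNReal.toReal_ofReal (by linarith)
  rw [PiLp.norm_eq_sum (by rw [h]; linarith), h]
  simp [pNorm]

theorem pnet {d : ℕ} (p : ℝ) (hp : 1 ≤ p) (R r : ℝ) (hR : 0 ≤ R) (hr : 0 < r) :
    ∃ C : Finset (Fin d → ℝ), (∀ c ∈ C, pNorm p c ≤ R) ∧
      (C.card : ℝ) ≤ (1 + 2 * R / r) ^ d ∧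
      ∀ w, pNorm p w ≤ R → ∃ c ∈ C, pNorm p (w - c) ≤ r := by
  classical
  have : Fact (1 ≤ ENNReal.ofReal p) := ⟨by simpa using hp⟩
  obtain ⟨C, h1, h2, h3⟩ := exists_net (E := PiLp (ENNReal.ofReal p) (fun _ : Fin d => ℝ)) R r hR hr
  refine ⟨C.image (fun c => WithLp.ofLp c), ?_, ?_, ?_⟩
  · intro c hc
    obtain ⟨c', hc', rfl⟩ := Finset.mem_image.1 hc
    rw [← pnorm_eq p hp]; exact h1 c' hc'
  · have e : Module.finrank ℝ (PiLp (ENNReal.ofReal p) (fun _ : Fin d => ℝ)) = d := by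
      rw [LinearEquiv.finrank_eq (WithLp.linearEquiv (ENNReal.ofReal p) ℝ (Fin d → ℝ)),
        Module.finrank_fin_fun]
    rw [e] at h2
    refine le_trans ?_ h2
    exact_mod_cast Finset.card_image_le
  · intro w hw
    rw [← pnorm_eq p hp] at hw
    obtain ⟨c, hc, h⟩ := h3 _ hw
    refine ⟨_, Finset.mem_image_of_mem _ hc, ?_⟩
    rw [← pnorm_eq p hp]; exact h

theorem Esign_mono {n : ℕ} {f g : (Fin n → ℝ) → ℝ}
    (h : ∀ σ, (∀ i, |σ i| = 1) → f σ ≤ g σ) : Esign n f ≤ Esign n g := by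
  unfold Esign
  gcongr with s
  apply h
  intro i; split_ifs <;> simp

theorem Esign_add {n : ℕ} (f g : (Fin n → ℝ) → ℝ) :
    Esign n (fun σ => f σ + g σ) = Esign n f + Esign n g := by
  simp only [Esign, Finset.sum_add_distrib, add_div]

theorem Esign_mul {n : ℕ} (c : ℝ) (f : (Fin n → ℝ) → ℝ) :
    Esign n (fun σ => c * f σ) = c * Esign n f := by
  simp only [Esign, ← Finset.mul_sum, mul_div_assoc]

theorem Esign_const {n : ℕ} (c : ℝ) : Esign n (fun _ => c) = c := by
  simp [Esign]

theorem Esign_sum {n : ℕ} {J : Type*} (C : Finset J) (f : J → (Fin n → ℝ) → ℝ) :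
    Esign n (fun σ => ∑ j ∈ C, f j σ) = ∑ j ∈ C, Esign n (f j) := by
  simp only [Esign]
  rw [Finset.sum_comm, Finset.sum_div]

theorem Esign_exp {n : ℕ} (a : Fin n → ℝ) :
    Esign n (fun σ => Real.exp (∑ i, σ i * a i)) = ∏ i, Real.cosh (a i) := by
  unfold Esign
  have h : ∀ i, Real.cosh (a i) = (∑ b : Bool, Real.exp ((if b then (1:ℝ) else -1) * a i)) / 2 := by
    intro i; simp [Real.cosh_eq]
  simp only [h, Finset.prod_div_distrib, Finset.prod_univ_sum, Real.exp_sum]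
  rw [Fintype.piFinset_univ]
  simp

theorem massart {n : ℕ} (hn : 1 ≤ n) {J : Type*} (C : Finset J) (a : J → Fin n → ℝ) (B L : ℝ)
    (hB : 0 ≤ B) (hL : 0 < L) (ha : ∀ j ∈ C, ∀ i, |a j i| ≤ B) (hC : (C.card : ℝ) ≤ Real.exp L)
    (M : (Fin n → ℝ) → ℝ) (hM : ∀ σ, ∃ j ∈ C, M σ ≤ ∑ i, σ i * a j i) :
    Esign n M ≤ B * Real.sqrt (2 * n * L) := by
  have hn' : (0:ℝ) < n := by exact_mod_cast hn
  rcases hB.eq_or_lt with rfl | hB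
  · rw [zero_mul]
    have : Esign n M ≤ Esign n (fun _ => 0) := by
      apply Esign_mono
      intro σ _
      obtain ⟨j, hj, h⟩ := hM σ
      refine h.trans (le_of_eq (Finset.sum_eq_zero fun i _ => ?_))
      have := abs_nonpos_iff.1 (ha j hj i)
      simp [this]
    rwa [Esign_const] at this
  set l : ℝ := Real.sqrt (2 * L / n) / B with hl
  have hlp : 0 < l := by positivity
  have hl2 : (l * B) ^ 2 = 2 * L / n := by
    rw [hl, div_mul_cancel₀ _ hB.ne', Real.sq_sqrt (by positivity)]
  have key : l * Esign n M ≤ 2 * L := by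
    have h1 : Esign n (fun σ => l * M σ) ≤
        Esign n (fun σ => Real.exp (-(2*L)) * (∑ j ∈ C, Real.exp (∑ i, σ i * (l * a j i)))
          + (2 * L - 1)) := by
      apply Esign_mono
      intro σ _
      obtain ⟨j, hj, h⟩ := hM σ
      have e1 := Real.add_one_le_exp (l * M σ - 2 * L)
      have e2 : Real.exp (l * M σ) ≤ ∑ j ∈ C, Real.exp (∑ i, σ i * (l * a j i)) := by
        refine le_trans ?_ (Finset.single_le_sum (f := fun j => Real.exp (∑ i, σ i * (l * a j i)))
          (fun _ _ => (Real.exp_pos _).le) hj)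
        apply Real.exp_le_exp.2
        calc l * M σ ≤ l * ∑ i, σ i * a j i := by gcongr
          _ = _ := by rw [Finset.mul_sum]; exact Finset.sum_congr rfl fun i _ => by ring
      have e3 : Real.exp (l * M σ - 2 * L) = Real.exp (-(2*L)) * Real.exp (l * M σ) := by
        rw [← Real.exp_add]; ring_nf
      have e4 := mul_le_mul_of_nonneg_left e2 (Real.exp_pos (-(2*L))).le
      linarith
    rw [Esign_mul, Esign_add, Esign_mul, Esign_sum, Esign_const] at h1
    have h2 : ∀ j ∈ C, Esign n (fun σ => Real.exp (∑ i, σ i * (l * a j i))) ≤ Real.exp L := by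
      intro j hj
      rw [Esign_exp]
      calc ∏ i, Real.cosh (l * a j i) ≤ ∏ i : Fin n, Real.exp (L / n) := by
            apply Finset.prod_le_prod
            · intro i _; exact (Real.cosh_pos _).le
            · intro i _
              refine (Real.cosh_le_exp_half_sq _).trans (Real.exp_le_exp.2 ?_)
              have : (l * a j i)^2 ≤ (l * B)^2 := by
                rw [mul_pow, mul_pow]
                have := sq_le_sq' (abs_le.1 (ha j hj i)).1 (abs_le.1 (ha j hj i)).2
                gcongr
              rw [hl2] at this
              calc _ ≤ (2 * L / n) / 2 := by gcongr
                _ = _ := by ring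
        _ = Real.exp L := by
            rw [Finset.prod_const, ← Real.exp_nat_mul]; simp; field_simp
    have h3 : ∑ j ∈ C, Esign n (fun σ => Real.exp (∑ i, σ i * (l * a j i))) ≤ Real.exp (2 * L) := by
      refine (Finset.sum_le_sum h2).trans ?_
      rw [Finset.sum_const, nsmul_eq_mul, two_mul, Real.exp_add]
      gcongr
    have h4 := mul_le_mul_of_nonneg_left h3 (Real.exp_pos (-(2*L))).le
    rw [← Real.exp_add] at h4
    simp at h4
    linarith
  have e : B * Real.sqrt (2 * n * L) * l = 2 * L := by
    rw [hl]
    have : Real.sqrt (2 * n * L) * Real.sqrt (2 * L / n) = 2 * L := by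
      rw [← Real.sqrt_mul (by positivity)]
      rw [show 2 * n * L * (2 * L / n) = (2 * L)^2 by field_simp; ]
      exact Real.sqrt_sq (by positivity)
    field_simp
    linarith
  nlinarith

theorem holder {d : ℕ} (p : ℝ) (hp : 1 ≤ p) (w x : Fin d → ℝ) :
    |ip w x| ≤ pNorm p w * (if p = 1 then supNorm x else pNorm (p / (p - 1)) x) := by
  have h1 : |ip w x| ≤ ∑ i, |w i| * |x i| := by
    refine (Finset.abs_sum_le_sum_abs _ _).trans (le_of_eq ?_)
    simp [abs_mul]
  refine h1.trans ?_
  split_ifs with h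
  · subst h
    simp only [pNorm, Real.rpow_one, div_one, Finset.sum_mul]
    gcongr with i
    exact le_ciSup (f := fun i => |x i|) (Set.finite_range _).bddAbove i
  · have hp1 : 1 < p := lt_of_le_of_ne hp (Ne.symm h)
    have := Real.inner_le_Lp_mul_Lq Finset.univ (fun i => |w i|) (fun i => |x i|)
      (Real.HolderConjugate.conjExponent hp1)
    simpa [pNorm, Real.conjExponent] using this

theorem holder_sup {d : ℕ} (p : ℝ) (hp : 1 ≤ p) (w x : Fin d → ℝ) (ε : ℝ) (hε : 0 ≤ ε)
    (hx : supNorm x ≤ ε) :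
    |ip w x| ≤ pNorm p w * (ε * (d : ℝ) ^ (1 - 1 / p)) := by
  have h1 : |ip w x| ≤ ∑ i, |w i| * |x i| := by
    refine (Finset.abs_sum_le_sum_abs _ _).trans (le_of_eq ?_)
    simp [abs_mul]
  have h2 : ∑ i, |w i| * |x i| ≤ (∑ i, |w i|) * ε := by
    rw [Finset.sum_mul]
    gcongr with i
    exact (le_ciSup (f := fun i => |x i|) (Set.finite_range _).bddAbove i).trans hx
  have h3 : ∑ i, |w i| ≤ (d : ℝ) ^ (1 - 1 / p) * pNorm p w := by
    have := Real.rpow_sum_le_const_mul_sum_rpow Finset.univ w hp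
    have h0 : 0 ≤ ∑ i, |w i| := Finset.sum_nonneg fun _ _ => abs_nonneg _
    have hS : 0 ≤ ∑ i, |w i| ^ p := Finset.sum_nonneg fun _ _ => by positivity
    have h4 := Real.rpow_le_rpow (by positivity) this (by positivity : 0 ≤ 1 / p)
    rw [← Real.rpow_mul h0, mul_one_div_cancel (by linarith), Real.rpow_one,
      Real.mul_rpow (by positivity) hS, ← Real.rpow_mul (by positivity)] at h4
    have e : (p - 1) * (1 / p) = 1 - 1 / p := by
      have : p ≠ 0 := by linarith
      field_simp
    rw [e] at h4
    simpa [pNorm] using h4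
  calc _ ≤ _ := h1
    _ ≤ _ := h2
    _ ≤ ((d : ℝ) ^ (1 - 1 / p) * pNorm p w) * ε := by gcongr
    _ = _ := by ring

theorem infdiff {ι : Type*} (P : ι → Prop) (hP : ∃ δ, P δ) (f g : ι → ℝ) (α β c : ℝ)
    (hf : ∃ m, ∀ δ, P δ → m ≤ f δ) (hg : ∃ m, ∀ δ, P δ → m ≤ g δ)
    (h : ∀ δ, P δ → |(f δ - α) - (g δ - β)| ≤ c) :
    |(sInf {t : ℝ | ∃ δ, P δ ∧ t = f δ} - α) - (sInf {t : ℝ | ∃ δ, P δ ∧ t = g δ} - β)| ≤ c := by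
  obtain ⟨δ₀, h0⟩ := hP
  obtain ⟨m, hm⟩ := hf
  obtain ⟨m', hm'⟩ := hg
  have bf : BddBelow {t : ℝ | ∃ δ, P δ ∧ t = f δ} := ⟨m, by rintro _ ⟨δ, hδ, rfl⟩; exact hm δ hδ⟩
  have bg : BddBelow {t : ℝ | ∃ δ, P δ ∧ t = g δ} := ⟨m', by rintro _ ⟨δ, hδ, rfl⟩; exact hm' δ hδ⟩
  have h1 : sInf {t : ℝ | ∃ δ, P δ ∧ t = f δ} - α + β - c ≤ sInf {t : ℝ | ∃ δ, P δ ∧ t = g δ} := by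
    refine le_csInf ⟨_, ⟨δ₀, h0, rfl⟩⟩ ?_
    rintro _ ⟨δ, hδ, rfl⟩
    have := csInf_le bf ⟨δ, hδ, rfl⟩
    have := abs_le.1 (h δ hδ)
    linarith
  have h2 : sInf {t : ℝ | ∃ δ, P δ ∧ t = g δ} - β + α - c ≤ sInf {t : ℝ | ∃ δ, P δ ∧ t = f δ} := by
    refine le_csInf ⟨_, ⟨δ₀, h0, rfl⟩⟩ ?_
    rintro _ ⟨δ, hδ, rfl⟩
    have := csInf_le bg ⟨δ, hδ, rfl⟩
    have := abs_le.1 (h δ hδ)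
    linarith
  rw [abs_le]; constructor <;> linarith

theorem ip_add_right {d : ℕ} (w x y : Fin d → ℝ) : ip w (x + y) = ip w x + ip w y := by
  simp [ip, mul_add, Finset.sum_add_distrib]

theorem ip_sub_left {d : ℕ} (w x y : Fin d → ℝ) : ip (w - x) y = ip w y - ip x y := by
  simp [ip, sub_mul, Finset.sum_sub_distrib]

theorem qbound {d : ℕ} (p : ℝ) (w w' x δ : Fin d → ℝ) (a b e X : ℝ)
    (hX : 0 ≤ X) (he : 0 ≤ e) (ha : 0 ≤ a) (hb : 0 ≤ b)
    (h1 : ∀ w, |ip w x| ≤ pNorm p w * X) (h2 : ∀ w, |ip w δ| ≤ pNorm p w * e)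
    (hw : pNorm p w ≤ a) (hw' : pNorm p w' ≤ b) :
    |ip w (x + δ) * ip w' (x + δ) - ip w x * ip w' x| ≤ a * b * (e * (e + 2 * X)) := by
  have A := (h1 w).trans (mul_le_mul_of_nonneg_right hw hX)
  have A' := (h1 w').trans (mul_le_mul_of_nonneg_right hw' hX)
  have D := (h2 w).trans (mul_le_mul_of_nonneg_right hw he)
  have D' := (h2 w').trans (mul_le_mul_of_nonneg_right hw' he)
  rw [ip_add_right, ip_add_right]
  have e1 := mul_le_mul A D' (abs_nonneg _) (by positivity)
  have e2 := mul_le_mul D A' (abs_nonneg _) (by positivity)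
  have e3 := mul_le_mul D D' (abs_nonneg _) (by positivity)
  rw [← abs_mul] at e1 e2 e3
  rw [show (ip w x + ip w δ) * (ip w' x + ip w' δ) - ip w x * ip w' x =
    ip w x * ip w' δ + ip w δ * ip w' x + ip w δ * ip w' δ by ring]
  refine (abs_add_three _ _ _).trans ?_
  nlinarith

set_option maxHeartbeats 2000000 in
theorem stmt3 {d n : ℕ} (hd : 1 ≤ d) (hn : 1 ≤ n) (p W ε : ℝ) (hp : 1 ≤ p) (hW : 0 < W)
    (hε : 0 ≤ ε) (x : Fin n → Fin d → ℝ) :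
    Esign n (fun σ => sSup {r : ℝ | ∃ w w' : Fin d → ℝ,
        pNorm p w ≤ W ∧ pNorm p w' ≤ W ∧
        r = (1 / (n : ℝ)) * ∑ i, σ i *
          sInf {t : ℝ | ∃ δ : Fin d → ℝ, supNorm δ ≤ ε ∧
            t = ip w (x i + δ) * ip w' (x i + δ)}}) ≤
      Esign n (fun σ => sSup {r : ℝ | ∃ w w' : Fin d → ℝ,
        pNorm p w ≤ W ∧ pNorm p w' ≤ W ∧
        r = (1 / (n : ℝ)) * ∑ i, σ i * (ip w (x i) * ip w' (x i))}) +
      2 * ε * ((d : ℝ) ^ (1 - 1 / p)) * W ^ 2 / Real.sqrt (n : ℝ) *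
        (1 + Real.sqrt ((d : ℝ) * Real.log (3 * Real.sqrt (n : ℝ)))) *
        (ε * ((d : ℝ) ^ (1 - 1 / p)) +
          2 * (⨆ i, (if p = 1 then supNorm (x i) else pNorm (p / (p - 1)) (x i)))) := by
  classical
  have hn' : (0:ℝ) < n := by exact_mod_cast hn
  have hn1 : (1:ℝ) ≤ n := by exact_mod_cast hn
  have hsn : 0 < Real.sqrt n := Real.sqrt_pos.2 hn'
  have hsn1 : 1 ≤ Real.sqrt n := Real.one_le_sqrt.2 hn1
  have hss : Real.sqrt n * Real.sqrt n = n := Real.mul_self_sqrt hn'.le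
  set D : ℝ := (d : ℝ) ^ (1 - 1 / p) with hD
  have hD0 : 0 ≤ D := by positivity
  set X : ℝ := ⨆ i, (if p = 1 then supNorm (x i) else pNorm (p / (p - 1)) (x i)) with hXdef
  have hXi : ∀ i, (if p = 1 then supNorm (x i) else pNorm (p / (p - 1)) (x i)) ≤ X := fun i =>
    le_ciSup (f := fun i => (if p = 1 then supNorm (x i) else pNorm (p / (p - 1)) (x i)))
      (Set.finite_range _).bddAbove i
  have hpn : ∀ (q : ℝ) (v : Fin d → ℝ), 0 ≤ pNorm q v := fun q v => by
    unfold pNorm; exact Real.rpow_nonneg (Finset.sum_nonneg fun _ _ => by positivity) _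
  have hX0 : 0 ≤ X := by
    refine le_trans ?_ (hXi ⟨0, hn⟩)
    split_ifs
    · exact Real.iSup_nonneg fun i => abs_nonneg _
    · exact hpn _ _
  set e : ℝ := ε * D with he
  have he0 : 0 ≤ e := by positivity
  have hx1 : ∀ i w, |ip w (x i)| ≤ pNorm p w * X := fun i w =>
    (holder p hp w (x i)).trans (mul_le_mul_of_nonneg_left (hXi i) (hpn _ _))
  have hx2 : ∀ δ : Fin d → ℝ, supNorm δ ≤ ε → ∀ w, |ip w δ| ≤ pNorm p w * e := fun δ hδ w =>
    holder_sup p hp w δ ε hε hδ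
  have hP : ∃ δ : Fin d → ℝ, supNorm δ ≤ ε := ⟨0, by simpa [supNorm] using hε⟩
  set Q : ℝ := e * (e + 2 * X) with hQ
  have hQ0 : 0 ≤ Q := by positivity
  set G : (Fin d → ℝ) × (Fin d → ℝ) → Fin n → ℝ := fun w i =>
    sInf {t : ℝ | ∃ δ : Fin d → ℝ, supNorm δ ≤ ε ∧ t = ip w.1 (x i + δ) * ip w.2 (x i + δ)} -
      ip w.1 (x i) * ip w.2 (x i) with hG
  have hlow : ∀ (w w' : Fin d → ℝ) i, ∃ m : ℝ, ∀ δ : Fin d → ℝ, supNorm δ ≤ ε →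
      m ≤ ip w (x i + δ) * ip w' (x i + δ) := by
    intro w w' i
    refine ⟨ip w (x i) * ip w' (x i) - pNorm p w * pNorm p w' * Q, fun δ hδ => ?_⟩
    have := abs_le.1 (qbound p w w' (x i) δ _ _ e X hX0 he0 (hpn p w) (hpn p w') (hx1 i)
      (hx2 δ hδ) le_rfl le_rfl)
    linarith
  have hGb : ∀ w : (Fin d → ℝ) × (Fin d → ℝ), pNorm p w.1 ≤ W → pNorm p w.2 ≤ W → ∀ i,
      |G w i| ≤ W ^ 2 * Q := by
    intro w h1 h2 i
    have := infdiff (fun δ : Fin d → ℝ => supNorm δ ≤ ε) hP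
      (fun δ => ip w.1 (x i + δ) * ip w.2 (x i + δ)) (fun _ => 0)
      (ip w.1 (x i) * ip w.2 (x i)) 0 (W ^ 2 * Q) (hlow w.1 w.2 i) ⟨0, fun _ _ => le_rfl⟩ (by
        intro δ hδ
        have := qbound p w.1 w.2 (x i) δ W W e X hX0 he0 hW.le hW.le (hx1 i) (hx2 δ hδ) h1 h2
        rw [sub_zero, sub_zero, sq]; exact this)
    have e0 : sInf {t : ℝ | ∃ δ : Fin d → ℝ, supNorm δ ≤ ε ∧ t = 0} = 0 := by
      have : {t : ℝ | ∃ δ : Fin d → ℝ, supNorm δ ≤ ε ∧ t = 0} = {0} := by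
        ext t
        simp [hP]
      rw [this, csInf_singleton]
    rw [e0, sub_zero, sub_zero] at this
    exact this
  have hGl : ∀ w c : (Fin d → ℝ) × (Fin d → ℝ), pNorm p w.2 ≤ W → pNorm p c.1 ≤ W →
      pNorm p (w.1 - c.1) ≤ W / Real.sqrt n → pNorm p (w.2 - c.2) ≤ W / Real.sqrt n → ∀ i,
      |G w i - G c i| ≤ 2 * (W ^ 2 * Q) / Real.sqrt n := by
    intro w c h1 h2 h3 h4 i
    refine infdiff (fun δ : Fin d → ℝ => supNorm δ ≤ ε) hP
      (fun δ => ip w.1 (x i + δ) * ip w.2 (x i + δ)) (fun δ => ip c.1 (x i + δ) * ip c.2 (x i + δ))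
      (ip w.1 (x i) * ip w.2 (x i)) (ip c.1 (x i) * ip c.2 (x i)) _ (hlow w.1 w.2 i)
      (hlow c.1 c.2 i) ?_
    intro δ hδ
    have q1 := qbound p (w.1 - c.1) w.2 (x i) δ (W / Real.sqrt n) W e X hX0 he0 (by positivity)
      hW.le (hx1 i) (hx2 δ hδ) h3 h1
    have q2 := qbound p c.1 (w.2 - c.2) (x i) δ W (W / Real.sqrt n) e X hX0 he0 hW.le
      (by positivity) (hx1 i) (hx2 δ hδ) h2 h4
    simp only [ip_sub_left] at q1 q2
    have q3 := (abs_add_le _ _).trans (add_le_add q1 q2)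
    have e1 : W / Real.sqrt n * W * (e * (e + 2 * X)) + W * (W / Real.sqrt n) * (e * (e + 2 * X))
      = 2 * (W ^ 2 * Q) / Real.sqrt n := by rw [hQ]; ring
    rw [e1] at q3
    refine le_trans (le_of_eq ?_) q3
    congr 1
    ring
  obtain ⟨C, hC1, hC2, hC3⟩ := pnet (d := d) p hp W (W / Real.sqrt n) hW.le (by positivity)
  have hp0 : pNorm p (0 : Fin d → ℝ) ≤ W := by
    have : p ≠ 0 := by linarith
    simp [pNorm, Real.zero_rpow, this, hW.le]
  have hCne : (C ×ˢ C).Nonempty := by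
    obtain ⟨c, hc, _⟩ := hC3 0 hp0
    exact ⟨(c, c), Finset.mk_mem_product hc hc⟩
  set l : ℝ := Real.log (3 * Real.sqrt n) with hl
  have hl0 : 0 < l := Real.log_pos (by linarith)
  have hd' : (0:ℝ) < d := by exact_mod_cast hd
  have hcard : ((C ×ˢ C).card : ℝ) ≤ Real.exp (2 * d * l) := by
    have h1 : (C.card : ℝ) ≤ (3 * Real.sqrt n) ^ d := by
      refine hC2.trans ?_
      have : 2 * W / (W / Real.sqrt n) = 2 * Real.sqrt n := by field_simp
      rw [this]
      gcongr
      linarith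
    have h2 : Real.exp (2 * d * l) = (3 * Real.sqrt n) ^ d * (3 * Real.sqrt n) ^ d := by
      rw [show 2 * d * l = d * l + d * l by ring, Real.exp_add, Real.exp_nat_mul, hl,
        Real.exp_log (by positivity)]
    rw [h2, Finset.card_product]
    push_cast
    exact mul_le_mul h1 h1 (Nat.cast_nonneg _) (by positivity)
  set M : (Fin n → ℝ) → ℝ := fun σ => (C ×ˢ C).sup' hCne (fun c => ∑ i, σ i * G c i) with hM
  have hmass : Esign n M ≤ W ^ 2 * Q * Real.sqrt (2 * n * (2 * d * l)) := by
    refine massart hn (C ×ˢ C) G (W ^ 2 * Q) (2 * d * l) (by positivity) (by positivity) ?_ hcard M ?_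
    · intro c hc
      obtain ⟨h1, h2⟩ := Finset.mem_product.1 hc
      exact hGb c (hC1 _ h1) (hC1 _ h2)
    · intro σ
      obtain ⟨j, hj, h⟩ := Finset.exists_mem_eq_sup' hCne (fun c => ∑ i, σ i * G c i)
      exact ⟨j, hj, h.le⟩
  have hpt := Esign_mono (n := n) (f := fun σ => sSup {r : ℝ | ∃ w w' : Fin d → ℝ,
        pNorm p w ≤ W ∧ pNorm p w' ≤ W ∧
        r = (1 / (n : ℝ)) * ∑ i, σ i *
          sInf {t : ℝ | ∃ δ : Fin d → ℝ, supNorm δ ≤ ε ∧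
            t = ip w (x i + δ) * ip w' (x i + δ)}})
    (g := fun σ => sSup {r : ℝ | ∃ w w' : Fin d → ℝ,
        pNorm p w ≤ W ∧ pNorm p w' ≤ W ∧
        r = (1 / (n : ℝ)) * ∑ i, σ i * (ip w (x i) * ip w' (x i))} +
        ((1 / (n : ℝ)) * M σ + 2 * (W ^ 2 * Q) / Real.sqrt n)) (by
    intro σ hσ
    apply csSup_le
    · exact ⟨_, 0, 0, hp0, hp0, rfl⟩
    rintro _ ⟨w, w', hw, hw', rfl⟩
    have hbdd : BddAbove {r : ℝ | ∃ w w' : Fin d → ℝ,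
        pNorm p w ≤ W ∧ pNorm p w' ≤ W ∧
        r = (1 / (n : ℝ)) * ∑ i, σ i * (ip w (x i) * ip w' (x i))} := by
      refine ⟨(1 / (n : ℝ)) * ∑ i : Fin n, (W * X) * (W * X), ?_⟩
      rintro _ ⟨w, w', hw, hw', rfl⟩
      refine mul_le_mul_of_nonneg_left (Finset.sum_le_sum fun i _ => ?_) (by positivity)
      refine (le_abs_self _).trans ?_
      rw [abs_mul, hσ, one_mul, abs_mul]
      have a1 := (hx1 i w).trans (mul_le_mul_of_nonneg_right hw hX0)
      have a2 := (hx1 i w').trans (mul_le_mul_of_nonneg_right hw' hX0)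
      exact mul_le_mul a1 a2 (abs_nonneg _) (by positivity)
    have h1 := le_csSup hbdd ⟨w, w', hw, hw', rfl⟩
    obtain ⟨c, hc, hwc⟩ := hC3 w hw
    obtain ⟨c', hc', hwc'⟩ := hC3 w' hw'
    have h2 : ∑ i, σ i * G (c, c') i ≤ M σ :=
      Finset.le_sup' (fun c => ∑ i, σ i * G c i) (Finset.mk_mem_product hc hc')
    have h3 : ∑ i, σ i * (G (w, w') i - G (c, c') i) ≤
        ∑ i : Fin n, 2 * (W ^ 2 * Q) / Real.sqrt n := by
      apply Finset.sum_le_sum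
      intro i _
      refine (le_abs_self _).trans ?_
      rw [abs_mul, hσ, one_mul]
      exact hGl (w, w') (c, c') hw' (hC1 c hc) hwc hwc' i
    rw [Finset.sum_const, Finset.card_univ, Fintype.card_fin, nsmul_eq_mul] at h3
    have h4 : ∑ i, σ i * sInf {t : ℝ | ∃ δ : Fin d → ℝ, supNorm δ ≤ ε ∧
            t = ip w (x i + δ) * ip w' (x i + δ)} =
        ∑ i, σ i * (ip w (x i) * ip w' (x i)) + ∑ i, σ i * (G (w, w') i - G (c, c') i) +
          ∑ i, σ i * G (c, c') i := by
      rw [← Finset.sum_add_distrib, ← Finset.sum_add_distrib]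
      refine Finset.sum_congr rfl fun i _ => ?_
      simp only [hG]
      ring
    rw [h4]
    have h5 := mul_le_mul_of_nonneg_left (add_le_add h3 h2) (by positivity : 0 ≤ 1 / (n:ℝ))
    have h6 : 1 / (n:ℝ) * (n * (2 * (W ^ 2 * Q) / Real.sqrt n) + M σ) =
        1 / (n:ℝ) * M σ + 2 * (W ^ 2 * Q) / Real.sqrt n := by
      rw [mul_add, ← mul_assoc, one_div_mul_cancel hn'.ne']; ring
    rw [h6] at h5
    rw [add_assoc, mul_add]
    exact add_le_add h1 h5)
  rw [Esign_add, Esign_add, Esign_mul, Esign_const] at hpt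
  refine hpt.trans ?_
  gcongr
  have s1 : Real.sqrt (2 * n * (2 * d * l)) = 2 * Real.sqrt n * Real.sqrt (d * l) := by
    rw [show 2 * (n:ℝ) * (2 * d * l) = 2 ^ 2 * n * (d * l) by ring, Real.sqrt_mul (by positivity),
      Real.sqrt_mul (by positivity), Real.sqrt_sq (by norm_num)]
  have h7 := mul_le_mul_of_nonneg_left hmass (by positivity : 0 ≤ 1 / (n:ℝ))
  rw [s1] at h7
  refine (add_le_add_left h7 _).trans (le_of_eq ?_)
  have s2 : 1 / (n:ℝ) * (W ^ 2 * Q * (2 * Real.sqrt n * Real.sqrt (d * l))) =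
      2 * (W ^ 2 * Q) / Real.sqrt n * Real.sqrt (d * l) := by
    nth_rewrite 1 [← hss]
    field_simp
  rw [s2, hQ, he]
  ring
end

section
/- The empirical Rademacher complexity of the squared-loss class satisfies R(ℓ∘HΔH) ≤ (4W²/n) · ( √( 2 · ‖Σ_{i=1}^n (x_i x_iᵀ)²‖_2 · log(2d) ) + (1/3) · ‖X‖²_{2,∞} · log(2d) ) · κ, where κ = 1 if 1 ≤ p ≤ 2 and κ = d^{1−2/p} if p > 2. -/
open scoped BigOperators

open scoped InnerProductSpace

namespace S5

abbrev E (d : ℕ) := EuclideanSpace ℝ (Fin d)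

lemma scalar_aux (t : ℝ) (ht : 0 ≤ t) :
    Real.exp t - 1 ≤ 1 / 2 * t * (Real.exp t + 1) := by
  have hmono : MonotoneOn (fun t : ℝ => 1 / 2 * t * (Real.exp t + 1) - (Real.exp t - 1)) (Set.Ici 0) := by
    have hder : ∀ s : ℝ, HasDerivAt (fun t : ℝ => 1 / 2 * t * (Real.exp t + 1) - (Real.exp t - 1))
        (1 / 2 * 1 * (Real.exp s + 1) + 1 / 2 * s * Real.exp s - Real.exp s) s := by
      intro s
      have h1 := ((hasDerivAt_id s).const_mul (1/2)).mul ((Real.hasDerivAt_exp s).add_const 1)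
      have h2 := (Real.hasDerivAt_exp s).sub_const 1
      exact h1.sub h2
    refine monotoneOn_of_deriv_nonneg (convex_Ici 0) (fun s _ => (hder s).continuousAt.continuousWithinAt)
      (fun s _ => (hder s).differentiableAt.differentiableWithinAt) ?_
    intro s hs
    rw [(hder s).deriv]
    have h1 : 1 - s ≤ Real.exp (-s) := by linarith [Real.add_one_le_exp (-s)]
    have h2 : Real.exp s * Real.exp (-s) = 1 := by rw [← Real.exp_add]; simp
    nlinarith [Real.exp_pos s, mul_le_mul_of_nonneg_left h1 (Real.exp_pos s).le]
  have := hmono (Set.mem_Ici.2 le_rfl) (Set.mem_Ici.2 ht) ht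
  simp at this
  linarith

lemma scalar (s t : ℝ) :
    (Real.exp s - Real.exp t) * (s - t) ≤ 1 / 2 * (Real.exp s + Real.exp t) * (s - t) ^ 2 := by
  wlog h : t ≤ s generalizing s t
  · have := this t s (le_of_not_ge h)
    nlinarith
  have h1 := scalar_aux (s - t) (by linarith)
  have h2 : Real.exp s = Real.exp t * Real.exp (s - t) := by rw [← Real.exp_add]; ring_nf
  rw [h2]
  have h3 := mul_le_mul_of_nonneg_left h1 (mul_nonneg (Real.exp_pos t).le (sub_nonneg.2 h))
  nlinarith

lemma key {d : ℕ} (u v : OrthonormalBasis (Fin d) ℝ (E d)) (a b : Fin d → ℝ)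
    (P Q A : E d →ₗ[ℝ] E d) (hQ : Q.IsSymmetric) (hP : P.IsSymmetric)
    (hu : ∀ i, P (u i) = a i • u i) (hv : ∀ j, Q (v j) = b j • v j)
    (hA : ∀ z, P z - Q z = (2 : ℝ) • A z) (θ : ℝ) (hθ : 0 ≤ θ) :
    ∑ i, Real.exp (θ * a i) * ⟪u i, A (u i)⟫_ℝ - ∑ j, Real.exp (θ * b j) * ⟪v j, A (v j)⟫_ℝ ≤
      θ * (∑ i, Real.exp (θ * a i) * ‖A (u i)‖ ^ 2 + ∑ j, Real.exp (θ * b j) * ‖A (v j)‖ ^ 2) := by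
  have hA' : ∀ z, A z = (1 / 2 : ℝ) • (P z - Q z) := by
    intro z; rw [hA, smul_smul]; norm_num
  have e1 : ∀ i j, ⟪v j, A (u i)⟫_ℝ = 1 / 2 * (a i - b j) * ⟪v j, u i⟫_ℝ := by
    intro i j
    rw [hA', inner_smul_right, inner_sub_right, hu, inner_smul_right, ← hQ, hv, inner_smul_left]
    simp; ring
  have e2 : ∀ i j, ⟪u i, A (v j)⟫_ℝ = 1 / 2 * (a i - b j) * ⟪v j, u i⟫_ℝ := by
    intro i j
    rw [hA', inner_smul_right, inner_sub_right, hv, inner_smul_right, ← hP, hu, inner_smul_left,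
      real_inner_comm]
    simp; ring
  have f1 : ∀ i, ⟪u i, A (u i)⟫_ℝ = ∑ j, 1 / 2 * (a i - b j) * ⟪v j, u i⟫_ℝ ^ 2 := by
    intro i
    rw [← v.sum_inner_mul_inner]
    refine Finset.sum_congr rfl fun j _ => ?_
    rw [e1, real_inner_comm]; ring
  have f2 : ∀ j, ⟪v j, A (v j)⟫_ℝ = ∑ i, 1 / 2 * (a i - b j) * ⟪v j, u i⟫_ℝ ^ 2 := by
    intro j
    rw [← u.sum_inner_mul_inner]
    refine Finset.sum_congr rfl fun i _ => ?_
    rw [e2]; ring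
  have g1 : ∀ i, ‖A (u i)‖ ^ 2 = ∑ j, 1 / 4 * (a i - b j) ^ 2 * ⟪v j, u i⟫_ℝ ^ 2 := by
    intro i
    rw [← real_inner_self_eq_norm_sq, ← v.sum_inner_mul_inner]
    refine Finset.sum_congr rfl fun j _ => ?_
    rw [real_inner_comm, e1]; ring
  have g2 : ∀ j, ‖A (v j)‖ ^ 2 = ∑ i, 1 / 4 * (a i - b j) ^ 2 * ⟪v j, u i⟫_ℝ ^ 2 := by
    intro j
    rw [← real_inner_self_eq_norm_sq, ← u.sum_inner_mul_inner]
    refine Finset.sum_congr rfl fun i _ => ?_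
    rw [real_inner_comm, e2]; ring
  simp only [f1, f2, g1, g2, Finset.mul_sum]
  rw [Finset.sum_comm (s := (Finset.univ : Finset (Fin d))) (f := fun j i =>
    Real.exp (θ * b j) * (1 / 2 * (a i - b j) * ⟪v j, u i⟫_ℝ ^ 2)),
    Finset.sum_comm (s := (Finset.univ : Finset (Fin d))) (f := fun j i =>
    Real.exp (θ * b j) * (1 / 4 * (a i - b j) ^ 2 * ⟪v j, u i⟫_ℝ ^ 2)),
    ← Finset.sum_sub_distrib, ← Finset.sum_add_distrib, Finset.mul_sum]
  refine Finset.sum_le_sum fun i _ => ?_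
  rw [← Finset.sum_sub_distrib, ← Finset.sum_add_distrib, Finset.mul_sum]
  refine Finset.sum_le_sum fun j _ => ?_
  rcases hθ.eq_or_lt with h0 | hpos
  · rw [← h0]; simp
  have hs := scalar (θ * a i) (θ * b j)
  have hs' : (Real.exp (θ * a i) - Real.exp (θ * b j)) * (a i - b j) ≤
      1 / 2 * (Real.exp (θ * a i) + Real.exp (θ * b j)) * (a i - b j) ^ 2 * θ := by
    refine le_of_mul_le_mul_left ?_ hpos
    linarith
  have := mul_le_mul_of_nonneg_right hs' (sq_nonneg ⟪v j, u i⟫_ℝ)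
  linarith

/-- sign -/
def sg (b : Bool) : ℝ := if b then 1 else -1

lemma sg_not (b : Bool) : sg (!b) = - sg b := by cases b <;> simp [sg]
lemma sg_sq (b : Bool) : sg b * sg b = 1 := by cases b <;> simp [sg]

def flip {n : ℕ} (k : Fin n) (s : Fin n → Bool) : Fin n → Bool := Function.update s k (!(s k))

lemma flip_flip {n : ℕ} (k : Fin n) (s : Fin n → Bool) : flip k (flip k s) = s := by
  simp [flip]

noncomputable def A {d : ℕ} (y : E d) : E d →ₗ[ℝ] E d :=
  (innerₛₗ ℝ y).smulRight y

lemma A_apply {d : ℕ} (y z : E d) : A y z = ⟪y, z⟫_ℝ • y := rfl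

noncomputable def X {d n : ℕ} (y : Fin n → E d) (s : Fin n → Bool) : E d →ₗ[ℝ] E d :=
  ∑ k, sg (s k) • A (y k)

lemma X_apply {d n : ℕ} (y : Fin n → E d) (s : Fin n → Bool) (z : E d) :
    X y s z = ∑ k, sg (s k) • A (y k) z := by
  simp [X, LinearMap.sum_apply]

lemma A_symm {d : ℕ} (y : E d) : (A y).IsSymmetric := by
  intro z w
  rw [A_apply, A_apply, inner_smul_left, inner_smul_right, real_inner_comm y z]
  simp [mul_comm]

lemma X_symm {d n : ℕ} (y : Fin n → E d) (s : Fin n → Bool) : (X y s).IsSymmetric := by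
  intro z w
  rw [X_apply, X_apply, sum_inner, inner_sum]
  refine Finset.sum_congr rfl fun k _ => ?_
  rw [inner_smul_left, inner_smul_right, A_symm]
  simp

lemma frk (d : ℕ) : Module.finrank ℝ (E d) = d := by simp

noncomputable def ub {d n : ℕ} (y : Fin n → E d) (s : Fin n → Bool) :
    OrthonormalBasis (Fin d) ℝ (E d) := (X_symm y s).eigenvectorBasis (frk d)
noncomputable def ev {d n : ℕ} (y : Fin n → E d) (s : Fin n → Bool) :
    Fin d → ℝ := (X_symm y s).eigenvalues (frk d)

lemma X_ub {d n : ℕ} (y : Fin n → E d) (s : Fin n → Bool) (i : Fin d) :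
    X y s (ub y s i) = ev y s i • ub y s i :=
  (X_symm y s).apply_eigenvectorBasis (frk d) i

lemma X_flip {d n : ℕ} (y : Fin n → E d) (s : Fin n → Bool) (k : Fin n) (z : E d) :
    X y s z - X y (flip k s) z = (2 : ℝ) • (sg (s k) • A (y k)) z := by
  rw [X_apply, X_apply, ← Finset.sum_sub_distrib, Finset.sum_eq_single k]
  · simp [flip, sg_not, two_smul]
  · intro j _ hj; simp [flip, Function.update_of_ne hj]
  · simp

lemma sum_flip {n : ℕ} (k : Fin n) (f : (Fin n → Bool) → ℝ) :
    ∑ s, f (flip k s) = ∑ s, f s :=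
  Equiv.sum_comp (Function.Involutive.toPerm (flip k) (flip_flip k)) f

lemma step {d n : ℕ} (y : Fin n → E d) (k : Fin n) (θ : ℝ) (hθ : 0 ≤ θ) :
    ∑ s : Fin n → Bool, ∑ i, Real.exp (θ * ev y s i) * (sg (s k) * ⟪ub y s i, A (y k) (ub y s i)⟫_ℝ) ≤
      θ * ∑ s : Fin n → Bool, ∑ i, Real.exp (θ * ev y s i) * ‖A (y k) (ub y s i)‖ ^ 2 := by
  set T : (Fin n → Bool) → ℝ := fun s => ∑ i, Real.exp (θ * ev y s i) * (sg (s k) * ⟪ub y s i, A (y k) (ub y s i)⟫_ℝ) with hT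
  set S : (Fin n → Bool) → ℝ := fun s => ∑ i, Real.exp (θ * ev y s i) * ‖A (y k) (ub y s i)‖ ^ 2 with hS
  have h : ∀ s, T s + T (flip k s) ≤ θ * (S s + S (flip k s)) := by
    intro s
    have := key (ub y s) (ub y (flip k s)) (ev y s) (ev y (flip k s)) (X y s) (X y (flip k s))
      (sg (s k) • A (y k)) (X_symm _ _) (X_symm _ _) (X_ub _ _) (X_ub _ _) (X_flip y s k) θ hθ
    have hn : ‖sg (s k)‖ = 1 := by cases s k <;> simp [sg]
    simp only [LinearMap.smul_apply, inner_smul_right, norm_smul, hn, one_mul] at this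
    have e : T (flip k s) = - ∑ j, Real.exp (θ * ev y (flip k s) j) *
        (sg (s k) * ⟪ub y (flip k s) j, A (y k) (ub y (flip k s) j)⟫_ℝ) := by
      simp [hT, flip, sg_not]
    rw [e]
    simp only [hT, hS]
    linarith
  have h2 := Finset.sum_le_sum fun s (_ : s ∈ (Finset.univ : Finset (Fin n → Bool))) => h s
  rw [Finset.sum_add_distrib, sum_flip, ← Finset.mul_sum, Finset.sum_add_distrib, sum_flip] at h2
  linarith

noncomputable def m {d n : ℕ} (y : Fin n → E d) (θ : ℝ) : ℝ :=
  ∑ s : Fin n → Bool, ∑ i, Real.exp (θ * ev y s i)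

lemma m_deriv {d n : ℕ} (y : Fin n → E d) (θ : ℝ) :
    HasDerivAt (m y) (∑ s : Fin n → Bool, ∑ i, Real.exp (θ * ev y s i) * ev y s i) θ := by
  unfold m
  refine HasDerivAt.fun_sum (fun s _ => HasDerivAt.fun_sum (fun i _ => ?_))
  have := ((hasDerivAt_id θ).mul_const (ev y s i)).exp
  simpa using this

lemma ev_eq {d n : ℕ} (y : Fin n → E d) (s : Fin n → Bool) (i : Fin d) :
    ev y s i = ∑ k, sg (s k) * ⟪ub y s i, A (y k) (ub y s i)⟫_ℝ := by
  have h : ⟪ub y s i, X y s (ub y s i)⟫_ℝ = ev y s i := by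
    rw [X_ub, inner_smul_right, real_inner_self_eq_norm_sq, (ub y s).norm_eq_one]; simp
  rw [← h, X_apply, inner_sum]
  simp [inner_smul_right]

lemma m_deriv_le {d n : ℕ} (y : Fin n → E d) (v : ℝ)
    (hv : ∀ z : E d, ‖z‖ = 1 → ∑ k, ‖A (y k) z‖ ^ 2 ≤ v) (θ : ℝ) (hθ : 0 ≤ θ) :
    ∑ s : Fin n → Bool, ∑ i, Real.exp (θ * ev y s i) * ev y s i ≤ θ * v * m y θ := by
  calc ∑ s : Fin n → Bool, ∑ i, Real.exp (θ * ev y s i) * ev y s i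
      = ∑ k, ∑ s : Fin n → Bool, ∑ i, Real.exp (θ * ev y s i) * (sg (s k) * ⟪ub y s i, A (y k) (ub y s i)⟫_ℝ) := by
        symm; rw [Finset.sum_comm]
        refine Finset.sum_congr rfl fun s _ => ?_
        rw [Finset.sum_comm]
        refine Finset.sum_congr rfl fun i _ => ?_
        rw [← Finset.mul_sum, ← ev_eq]
    _ ≤ ∑ k, θ * ∑ s : Fin n → Bool, ∑ i, Real.exp (θ * ev y s i) * ‖A (y k) (ub y s i)‖ ^ 2 :=
        Finset.sum_le_sum fun k _ => step y k θ hθ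
    _ = θ * ∑ s : Fin n → Bool, ∑ i, Real.exp (θ * ev y s i) * ∑ k, ‖A (y k) (ub y s i)‖ ^ 2 := by
        rw [← Finset.mul_sum, Finset.sum_comm]
        congr 1
        refine Finset.sum_congr rfl fun s _ => ?_
        rw [Finset.sum_comm]
        refine Finset.sum_congr rfl fun i _ => ?_
        rw [← Finset.mul_sum]
    _ ≤ θ * ∑ s : Fin n → Bool, ∑ i, Real.exp (θ * ev y s i) * v := by
        gcongr with s _ i _
        exact hv _ ((ub y s).norm_eq_one i)
    _ = θ * v * m y θ := by
        simp only [m, ← Finset.sum_mul]; ring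

lemma m_le {d n : ℕ} (y : Fin n → E d) (v : ℝ)
    (hv : ∀ z : E d, ‖z‖ = 1 → ∑ k, ‖A (y k) z‖ ^ 2 ≤ v) (θ : ℝ) (hθ : 0 ≤ θ) :
    m y θ ≤ 2 ^ n * d * Real.exp (v * θ ^ 2 / 2) := by
  have hder : ∀ t : ℝ, HasDerivAt (fun t => m y t * Real.exp (-(v * t ^ 2 / 2)))
      ((∑ s : Fin n → Bool, ∑ i, Real.exp (t * ev y s i) * ev y s i) * Real.exp (-(v * t ^ 2 / 2))
        + m y t * (Real.exp (-(v * t ^ 2 / 2)) * (-(v * t)))) t := by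
    intro t
    refine (m_deriv y t).mul (HasDerivAt.exp ?_)
    have := (((hasDerivAt_pow 2 t).const_mul v).div_const 2).neg
    refine this.congr_deriv ?_
    simp; ring
  have hanti : AntitoneOn (fun t => m y t * Real.exp (-(v * t ^ 2 / 2))) (Set.Ici 0) := by
    refine antitoneOn_of_deriv_nonpos (convex_Ici 0) (fun s _ => (hder s).continuousAt.continuousWithinAt)
      (fun s _ => (hder s).differentiableAt.differentiableWithinAt) ?_
    intro t ht
    rw [(hder t).deriv]
    simp at ht
    have := mul_le_mul_of_nonneg_right (m_deriv_le y v hv t ht.le) (Real.exp_pos (-(v * t ^ 2 / 2))).le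
    linarith
  have h := hanti (Set.mem_Ici.2 le_rfl) (Set.mem_Ici.2 hθ) hθ
  have h0 : m y 0 = 2 ^ n * d := by simp [m]
  simp only [h0, Real.exp_neg] at h
  rw [← div_eq_mul_inv, div_le_iff₀ (Real.exp_pos _)] at h
  simpa using h

noncomputable def G {d n : ℕ} (y : Fin n → E d) (s : Fin n → Bool) : ℝ :=
  max 0 (⨆ i, ev y s i)

lemma ev_le_G {d n : ℕ} (y : Fin n → E d) (s : Fin n → Bool) (i : Fin d) : ev y s i ≤ G y s :=
  le_max_of_le_right (le_ciSup (f := ev y s) (Set.finite_range _).bddAbove i)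

lemma G_nonneg {d n : ℕ} (y : Fin n → E d) (s : Fin n → Bool) : 0 ≤ G y s := le_max_left _ _

lemma exp_G {d n : ℕ} (hd : 1 ≤ d) (y : Fin n → E d) (s : Fin n → Bool) (θ : ℝ) :
    Real.exp (θ * G y s) ≤ 1 + ∑ i, Real.exp (θ * ev y s i) := by
  have : Nonempty (Fin d) := ⟨⟨0, hd⟩⟩
  obtain ⟨i, hi⟩ := exists_eq_ciSup_of_finite (f := ev y s)
  have hs := Finset.single_le_sum (f := fun i => Real.exp (θ * ev y s i))
    (fun i _ => (Real.exp_pos _).le) (Finset.mem_univ i)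
  rcases max_choice 0 (⨆ i, ev y s i) with h | h
  · rw [G, h]; simp
    exact Finset.sum_nonneg fun i _ => (Real.exp_pos _).le
  · rw [G, h, ← hi]; linarith

lemma quad_le {d n : ℕ} (y : Fin n → E d) (s : Fin n → Bool) (z : E d) :
    ∑ k, sg (s k) * ⟪y k, z⟫_ℝ ^ 2 ≤ G y s * ‖z‖ ^ 2 := by
  have h1 : ∑ k, sg (s k) * ⟪y k, z⟫_ℝ ^ 2 = ⟪z, X y s z⟫_ℝ := by
    rw [X_apply, inner_sum]
    refine Finset.sum_congr rfl fun k _ => ?_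
    rw [inner_smul_right, A_apply, inner_smul_right, real_inner_comm z]
    ring
  rw [h1, ← (ub y s).sum_inner_mul_inner, ← real_inner_self_eq_norm_sq,
    ← (ub y s).sum_inner_mul_inner, Finset.mul_sum]
  refine Finset.sum_le_sum fun i _ => ?_
  rw [← X_symm y s, X_ub, inner_smul_left, real_inner_comm z]
  simp only [conj_trivial]
  nlinarith [mul_le_mul_of_nonneg_right (ev_le_G y s i) (mul_self_nonneg ⟪z, ub y s i⟫_ℝ)]

lemma EG_le {d n : ℕ} (hd : 1 ≤ d) (y : Fin n → E d) (v : ℝ) (hv0 : 0 ≤ v)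
    (hv : ∀ z : E d, ‖z‖ = 1 → ∑ k, ‖A (y k) z‖ ^ 2 ≤ v) :
    (∑ s, G y s) / 2 ^ n ≤ Real.sqrt (2 * v * Real.log (2 * (d : ℝ))) := by
  set g := (∑ s, G y s) / 2 ^ n with hg
  have hd' : (1 : ℝ) ≤ d := by exact_mod_cast hd
  have hg0 : 0 ≤ g := div_nonneg (Finset.sum_nonneg fun s _ => G_nonneg y s) (by positivity)
  have hL : 0 ≤ Real.log (2 * (d : ℝ)) := Real.log_nonneg (by linarith)
  have main : ∀ θ : ℝ, 0 ≤ θ → θ * g ≤ Real.log (2 * (d : ℝ)) + v * θ ^ 2 / 2 := by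
    intro θ hθ
    have hj : Real.exp (θ * g) ≤ (∑ s, Real.exp (θ * G y s)) / 2 ^ n := by
      have := convexOn_exp.map_sum_le (t := (Finset.univ : Finset (Fin n → Bool)))
        (w := fun _ => (1 / 2 ^ n : ℝ)) (p := fun s => θ * G y s) (fun _ _ => by positivity)
        (by simp) (fun _ _ => Set.mem_univ _)
      simp only [smul_eq_mul, ← Finset.mul_sum] at this
      calc _ = _ := by rw [hg]; congr 1; ring
        _ ≤ _ := this
        _ = _ := by ring
    have h2 : (∑ s, Real.exp (θ * G y s)) ≤ 2 ^ n + m y θ := by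
      calc _ ≤ ∑ s, (1 + ∑ i, Real.exp (θ * ev y s i)) :=
            Finset.sum_le_sum fun s _ => exp_G hd y s θ
        _ = _ := by simp [Finset.sum_add_distrib, m]
    have h3 := m_le y v hv θ hθ
    have h4 : Real.exp (θ * g) ≤ 2 * d * Real.exp (v * θ ^ 2 / 2) := by
      refine hj.trans ?_
      rw [div_le_iff₀ (by positivity)]
      have : 1 ≤ Real.exp (v * θ ^ 2 / 2) := Real.one_le_exp (by positivity)
      have h5 : 1 ≤ (d : ℝ) * Real.exp (v * θ ^ 2 / 2) := one_le_mul_of_one_le_of_one_le hd' this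
      nlinarith [pow_pos (two_pos : (0 : ℝ) < 2) n]
    have h6 := Real.log_le_log (Real.exp_pos _) h4
    rwa [Real.log_exp, Real.log_mul (by positivity) (by positivity), Real.log_exp] at h6
  apply Real.le_sqrt_of_sq_le
  have := discrim_le_zero (a := v / 2) (b := -g) (c := Real.log (2 * (d : ℝ))) (by
    intro t
    rcases le_total 0 t with ht | ht
    · linarith [main t ht]
    · nlinarith [mul_nonneg (neg_nonneg.2 ht) hg0, mul_nonneg hv0 (mul_self_nonneg t)])
  rw [discrim] at this
  linarith

lemma twoNorm_eq {d : ℕ} (v : Fin d → ℝ) : twoNorm v = ‖(WithLp.toLp 2 v : E d)‖ := by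
  simp [twoNorm, EuclideanSpace.norm_eq]

lemma ip_eq {d : ℕ} (w x : Fin d → ℝ) :
    ip w x = ⟪(WithLp.toLp 2 x : E d), WithLp.toLp 2 w⟫_ℝ := by
  simp [ip, PiLp.inner_apply]

lemma spec_bdd {d : ℕ} (M : Matrix (Fin d) (Fin d) ℝ) :
    BddAbove {y : ℝ | ∃ v : Fin d → ℝ, twoNorm v ≤ 1 ∧ y = twoNorm (M.mulVec v)} := by
  refine ⟨‖Matrix.toEuclideanCLM (𝕜 := ℝ) M‖, ?_⟩
  rintro _ ⟨v, hv, rfl⟩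
  rw [twoNorm_eq] at hv ⊢
  have := (Matrix.toEuclideanCLM (𝕜 := ℝ) M).le_opNorm (WithLp.toLp 2 v)
  rw [Matrix.toEuclideanCLM_toLp] at this
  refine this.trans ?_
  nlinarith [norm_nonneg (Matrix.toEuclideanCLM (𝕜 := ℝ) M)]

lemma outer_mulVec {d : ℕ} (x v : Fin d → ℝ) :
    (outer x).mulVec v = ip v x • x := by
  ext a
  simp [outer, Matrix.mulVec, dotProduct, ip, Finset.sum_mul]
  refine Finset.sum_congr rfl fun i _ => by ring

lemma spec_ge {d n : ℕ} (x : Fin n → Fin d → ℝ) (z : E d) (hz : ‖z‖ = 1) :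
    ∑ k, ‖A (WithLp.toLp 2 (x k) : E d) z‖ ^ 2 ≤ specNorm (∑ i, outer (x i) * outer (x i)) := by
  set M := ∑ i, outer (x i) * outer (x i) with hM
  have h1 : twoNorm (M.mulVec z.ofLp) ≤ specNorm M :=
    le_csSup (spec_bdd M) ⟨z.ofLp, by rw [twoNorm_eq]; exact hz.le, rfl⟩
  refine le_trans ?_ h1
  rw [twoNorm_eq]
  have h2 : (WithLp.toLp 2 (M.mulVec z.ofLp) : E d) =
      ∑ k, A (WithLp.toLp 2 (x k) : E d) (A (WithLp.toLp 2 (x k) : E d) z) := by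
    rw [hM, Matrix.sum_mulVec, WithLp.toLp_sum]
    refine Finset.sum_congr rfl fun k _ => ?_
    rw [← Matrix.mulVec_mulVec, outer_mulVec, outer_mulVec, ip_eq, ip_eq, A_apply, A_apply]
    simp
  have h3 : ∑ k, ‖A (WithLp.toLp 2 (x k) : E d) z‖ ^ 2 =
      ⟪z, (WithLp.toLp 2 (M.mulVec z.ofLp) : E d)⟫_ℝ := by
    rw [h2, inner_sum]
    refine Finset.sum_congr rfl fun k _ => ?_
    rw [← A_symm, real_inner_self_eq_norm_sq]
  rw [h3]
  refine (real_inner_le_norm _ _).trans ?_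
  rw [hz, one_mul]

lemma spec_nonneg {d : ℕ} (M : Matrix (Fin d) (Fin d) ℝ) : 0 ≤ specNorm M := by
  apply Real.sSup_nonneg
  rintro _ ⟨v, _, rfl⟩
  exact Real.sqrt_nonneg _

lemma pnorm_bound {d : ℕ} (hd : 1 ≤ d) (p W : ℝ) (hp : 1 ≤ p) (hW : 0 < W) (w : Fin d → ℝ)
    (h : pNorm p w ≤ W) :
    ∑ i, w i ^ 2 ≤ W ^ 2 * (if p ≤ 2 then 1 else (d : ℝ) ^ (1 - 2 / p)) := by
  have hp0 : 0 < p := by linarith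
  have hs0 : 0 ≤ ∑ i, |w i| ^ p := Finset.sum_nonneg fun i _ => Real.rpow_nonneg (abs_nonneg _) _
  have h1 : ∑ i, |w i| ^ p ≤ W ^ p := by
    have := Real.rpow_le_rpow (Real.rpow_nonneg hs0 _) h hp0.le
    rwa [← Real.rpow_mul hs0, one_div, inv_mul_cancel₀ hp0.ne', Real.rpow_one] at this
  split_ifs with h2
  · have hWp : 0 < W ^ p := Real.rpow_pos_of_pos hW _
    have hi : ∀ i, w i ^ 2 ≤ W ^ 2 * (|w i| ^ p / W ^ p) := by
      intro i
      have hle : |w i| ^ p ≤ W ^ p := (Finset.single_le_sum (f := fun i => |w i| ^ p)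
        (fun i _ => Real.rpow_nonneg (abs_nonneg _) _) (Finset.mem_univ i)).trans h1
      have hle' : |w i| ≤ W := (Real.rpow_le_rpow_iff (abs_nonneg _) hW.le hp0).1 hle
      have h3 : (|w i| / W) ^ (2 : ℝ) ≤ (|w i| / W) ^ p := by
        apply Real.rpow_le_rpow_of_exponent_ge' (by positivity) ((div_le_one hW).2 hle') hp0.le h2
      rw [Real.div_rpow (abs_nonneg _) hW.le, Real.div_rpow (abs_nonneg _) hW.le] at h3
      simp only [Real.rpow_two, sq_abs] at h3
      rw [div_le_iff₀ (by positivity)] at h3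
      linarith
    calc _ ≤ ∑ i, W ^ 2 * (|w i| ^ p / W ^ p) := Finset.sum_le_sum fun i _ => hi i
      _ = W ^ 2 * ((∑ i, |w i| ^ p) / W ^ p) := by rw [← Finset.mul_sum, Finset.sum_div]
      _ ≤ _ := by gcongr; exact (div_le_one hWp).2 h1
  · push Not at h2
    have hd0 : (0 : ℝ) < d := by exact_mod_cast hd
    have h3 := Real.rpow_sum_le_const_mul_sum_rpow (Finset.univ : Finset (Fin d))
      (fun i => w i ^ 2) (p := p / 2) (by linarith)
    have e : ∀ i, |w i ^ 2| ^ (p / 2) = |w i| ^ p := by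
      intro i
      rw [abs_pow, ← Real.rpow_natCast, ← Real.rpow_mul (abs_nonneg _)]
      congr 1; push_cast; ring
    simp only [e, Finset.card_univ, Fintype.card_fin] at h3
    have e2 : ∀ i, |w i ^ 2| = w i ^ 2 := fun i => abs_of_nonneg (sq_nonneg _)
    simp only [e2] at h3
    have h4 : (∑ i, w i ^ 2) ^ (p / 2) ≤ (d : ℝ) ^ (p / 2 - 1) * W ^ p := h3.trans (by gcongr)
    have hq : 0 ≤ ∑ i, w i ^ 2 := Finset.sum_nonneg fun i _ => sq_nonneg _
    rw [← Real.rpow_le_rpow_iff hq (by positivity) (show 0 < p / 2 by linarith)]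
    refine h4.trans (le_of_eq ?_)
    rw [Real.mul_rpow (by positivity) (by positivity), ← Real.rpow_mul hd0.le,
      ← Real.rpow_natCast, ← Real.rpow_mul hW.le, mul_comm]
    congr 2
    · push_cast; ring
    · field_simp
end S5

theorem stmt5 {d n : ℕ} (hd : 1 ≤ d) (hn : 1 ≤ n) (p W : ℝ) (hp : 1 ≤ p) (hW : 0 < W)
    (x : Fin n → Fin d → ℝ) :
    Esign n (fun σ => sSup {r : ℝ | ∃ w w' : Fin d → ℝ,
        pNorm p w ≤ W ∧ pNorm p w' ≤ W ∧
        r = (1 / (n : ℝ)) * ∑ i, σ i * (ip w (x i) - ip w' (x i)) ^ 2}) ≤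
      4 * W ^ 2 / (n : ℝ) *
        (Real.sqrt (2 * specNorm (∑ i, outer (x i) * outer (x i)) * Real.log (2 * (d : ℝ))) +
          (1 / 3) * (⨆ i, twoNorm (x i)) ^ 2 * Real.log (2 * (d : ℝ))) *
        (if p ≤ 2 then 1 else (d : ℝ) ^ (1 - 2 / p)) := by
  have hd0 : (0 : ℝ) < d := by exact_mod_cast hd
  have hn0 : (0 : ℝ) < n := by exact_mod_cast hn
  set κ : ℝ := if p ≤ 2 then 1 else (d : ℝ) ^ (1 - 2 / p) with hκ
  have hκ0 : 0 ≤ κ := by rw [hκ]; split_ifs <;> positivity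
  set y : Fin n → S5.E d := fun i => WithLp.toLp 2 (x i) with hy
  have hEG := S5.EG_le hd y (specNorm (∑ i, outer (x i) * outer (x i))) (S5.spec_nonneg _)
    (fun z hz => S5.spec_ge x z hz)
  have hL : 0 ≤ Real.log (2 * (d : ℝ)) := by
    apply Real.log_nonneg
    have : (1 : ℝ) ≤ d := by exact_mod_cast hd
    linarith
  have hsup : ∀ s : Fin n → Bool, sSup {r : ℝ | ∃ w w' : Fin d → ℝ,
        pNorm p w ≤ W ∧ pNorm p w' ≤ W ∧
        r = (1 / (n : ℝ)) * ∑ i, (if s i then (1 : ℝ) else -1) * (ip w (x i) - ip w' (x i)) ^ 2}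
        ≤ 4 * W ^ 2 / n * κ * S5.G y s := by
    intro s
    have hG := S5.G_nonneg y s
    apply Real.sSup_le
    · rintro _ ⟨w, w', hw, hw', rfl⟩
      have h1 := S5.pnorm_bound hd p W hp hW w hw
      have h2 := S5.pnorm_bound hd p W hp hW w' hw'
      rw [← hκ] at h1 h2
      have hq := S5.quad_le y s (WithLp.toLp 2 w - WithLp.toLp 2 w')
      have hnorm : ‖(WithLp.toLp 2 w - WithLp.toLp 2 w' : S5.E d)‖ ^ 2 ≤ 4 * W ^ 2 * κ := by
        rw [EuclideanSpace.norm_sq_eq]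
        calc _ ≤ ∑ i, (2 * w i ^ 2 + 2 * w' i ^ 2) := by
              refine Finset.sum_le_sum fun i _ => ?_
              simp only [PiLp.sub_apply, Real.norm_eq_abs, sq_abs]
              nlinarith [sq_nonneg (w i + w' i)]
          _ ≤ _ := by
              rw [Finset.sum_add_distrib, ← Finset.mul_sum, ← Finset.mul_sum]; linarith
      have he : ∑ i, (if s i then (1 : ℝ) else -1) * (ip w (x i) - ip w' (x i)) ^ 2 =
          ∑ k, S5.sg (s k) * (inner ℝ (y k) (WithLp.toLp 2 w - WithLp.toLp 2 w')) ^ 2 := by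
        refine Finset.sum_congr rfl fun i _ => ?_
        rw [S5.ip_eq, S5.ip_eq, ← inner_sub_right]; rfl
      rw [he]
      have h5 := hq.trans (mul_le_mul_of_nonneg_left hnorm hG)
      calc _ ≤ 1 / (n : ℝ) * (S5.G y s * (4 * W ^ 2 * κ)) := by gcongr
        _ = _ := by ring
    · positivity
  unfold Esign
  calc _ ≤ (∑ s, 4 * W ^ 2 / n * κ * S5.G y s) / 2 ^ n := by
        gcongr with s _
        exact hsup s
    _ = 4 * W ^ 2 / n * ((∑ s, S5.G y s) / 2 ^ n) * κ := by rw [← Finset.mul_sum]; ring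
    _ ≤ _ := by
        gcongr
        refine hEG.trans (le_add_of_nonneg_right ?_)
        positivity
end

section
/- The adversarial Rademacher complexity of the squared-loss class satisfies R(ℓ̃∘HΔH) ≤ R(ℓ∘HΔH) + (4W²/n) · √d · ε · ( √d·ε + (2/n) Σ_{i=1}^n ‖x_i‖_2 + √( Σ_{i=1}^n (√d·ε + 2‖x_i‖_2)² ) · √( 2 d · log(6n) ) ) · κ, where κ = 1 if 1 ≤ p ≤ 2 and κ = d^{1−2/p} if p > 2. -/
open scoped BigOperators

def sg {n : ℕ} (s : Fin n → Bool) : Fin n → ℝ := fun i => if s i then (1 : ℝ) else -1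

def flipAt {n : ℕ} (j : Fin n) (s : Fin n → Bool) : Fin n → Bool := Function.update s j (!(s j))

lemma flipAt_invol {n : ℕ} (j : Fin n) : Function.Involutive (flipAt j) := by
  intro s
  simp [flipAt]

lemma sum_flip {n : ℕ} (j : Fin n) (F : (Fin n → Bool) → ℝ) :
    ∑ s, F (flipAt j s) = ∑ s, F s :=
  Equiv.sum_comp (flipAt_invol j).toPerm F

lemma sg_flip_self {n : ℕ} (j : Fin n) (s : Fin n → Bool) : sg (flipAt j s) j = - sg s j := by
  unfold sg flipAt
  cases h : s j <;> simp [h]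

lemma sg_flip_ne {n : ℕ} (j i : Fin n) (h : i ≠ j) (s : Fin n → Bool) :
    sg (flipAt j s) i = sg s i := by
  simp [sg, flipAt, Function.update_of_ne h]

lemma sg_sq {n : ℕ} (i : Fin n) (s : Fin n → Bool) : sg s i * sg s i = 1 := by
  unfold sg
  split_ifs <;> norm_num

lemma sum_sg {n : ℕ} (i : Fin n) : ∑ s : Fin n → Bool, sg s i = 0 := by
  have h := sum_flip i (fun s => sg s i)
  simp only [sg_flip_self, Finset.sum_neg_distrib] at h
  linarith

lemma sum_sg_mul {n : ℕ} (i j : Fin n) :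
    ∑ s : Fin n → Bool, sg s i * sg s j = if i = j then (2 : ℝ) ^ n else 0 := by
  split_ifs with h
  · subst h
    simp [sg_sq]
  · have h2 := sum_flip i (fun s => sg s i * sg s j)
    simp only [sg_flip_self, sg_flip_ne i j (Ne.symm h), neg_mul, Finset.sum_neg_distrib] at h2
    linarith

lemma second_moment {n : ℕ} (a : Fin n → ℝ) :
    ∑ s : Fin n → Bool, (∑ i, sg s i * a i) ^ 2 = 2 ^ n * ∑ i, a i ^ 2 := by
  have h1 : ∀ s : Fin n → Bool, (∑ i, sg s i * a i) ^ 2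
      = ∑ i, ∑ j, (sg s i * sg s j) * (a i * a j) := by
    intro s
    rw [sq, Finset.sum_mul_sum]
    refine Finset.sum_congr rfl fun i _ => Finset.sum_congr rfl fun j _ => by ring
  simp only [h1]
  rw [Finset.sum_comm, Finset.mul_sum]
  refine Finset.sum_congr rfl fun i _ => ?_
  rw [Finset.sum_comm]
  simp only [← Finset.sum_mul, sum_sg_mul]
  simp
  ring

lemma first_moment {n : ℕ} (f : (Fin n → Bool) → ℝ) (C : ℝ)
    (h : ∑ s, f s ^ 2 ≤ 2 ^ n * C) : ∑ s, f s ≤ 2 ^ n * Real.sqrt C := by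
  have h1 := sq_sum_le_card_mul_sum_sq (s := (Finset.univ : Finset (Fin n → Bool))) (f := f)
  have hc : ((Finset.univ : Finset (Fin n → Bool)).card : ℝ) = 2 ^ n := by simp
  rw [hc] at h1
  have h2 : (∑ s, f s) ^ 2 ≤ (2 ^ n) ^ 2 * C := by
    have : (2 : ℝ) ^ n * ∑ s, f s ^ 2 ≤ 2 ^ n * (2 ^ n * C) := by gcongr
    nlinarith
  have h3 := Real.le_sqrt_of_sq_le h2
  rwa [Real.sqrt_mul (by positivity), Real.sqrt_sq (by positivity)] at h3

/- one step of the contraction -/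
lemma contr_step {n : ℕ} {T : Type*} (P : T → Prop) (j : Fin n) (g : T → ℝ)
    (h : (Fin n → Bool) → T → ℝ) (hh : ∀ s t, h (flipAt j s) t = h s t)
    (t : (Fin n → Bool) → T) (ht : ∀ s, P (t s)) :
    ∃ t' : (Fin n → Bool) → T, (∀ s, P (t' s)) ∧
      ∑ s, (h s (t s) + sg s j * |g (t s)|) ≤ ∑ s, (h s (t' s) + sg s j * g (t' s)) := by
  classical
  let t' : (Fin n → Bool) → T := fun s =>
    if 0 ≤ sg s j * (g (t s) - g (t (flipAt j s))) then t s else t (flipAt j s)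
  refine ⟨t', ?_, ?_⟩
  · intro s
    simp only [t']
    split_ifs
    · exact ht s
    · exact ht _
  · have e1 := sum_flip j (fun s => h s (t s) + sg s j * |g (t s)|)
    have e2 := sum_flip j (fun s => h s (t' s) + sg s j * g (t' s))
    have key : ∑ s, ((h s (t s) + sg s j * |g (t s)|) +
          (h (flipAt j s) (t (flipAt j s)) + sg (flipAt j s) j * |g (t (flipAt j s))|))
        ≤ ∑ s, ((h s (t' s) + sg s j * g (t' s)) +
          (h (flipAt j s) (t' (flipAt j s)) + sg (flipAt j s) j * g (t' (flipAt j s)))) := by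
      refine Finset.sum_le_sum fun s _ => ?_
      simp only [hh, sg_flip_self, t', flipAt_invol j s]
      have hab := abs_sub_abs_le_abs_sub (g (t s)) (g (t (flipAt j s)))
      have hba := abs_sub_abs_le_abs_sub (g (t (flipAt j s))) (g (t s))
      rw [abs_sub_comm] at hba
      have hsame : -sg s j * (g (t (flipAt j s)) - g (t s))
          = sg s j * (g (t s) - g (t (flipAt j s))) := by ring
      rw [hsame]
      have hs : sg s j = 1 ∨ sg s j = -1 := by
        unfold sg; split_ifs <;> simp
      split_ifs with hc
      · rcases hs with hs | hs <;> rw [hs] at hc ⊢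
        · rw [abs_of_nonneg (by linarith : 0 ≤ g (t s) - g (t (flipAt j s)))] at hab
          linarith
        · rw [abs_of_nonpos (by linarith : g (t s) - g (t (flipAt j s)) ≤ 0)] at hba
          linarith
      · rcases hs with hs | hs <;> rw [hs] at hc ⊢
        · rw [abs_of_nonpos (by linarith : g (t s) - g (t (flipAt j s)) ≤ 0)] at hab
          linarith
        · rw [abs_of_nonneg (by linarith : 0 ≤ g (t s) - g (t (flipAt j s)))] at hba
          linarith
    simp only [Finset.sum_add_distrib] at key e1 e2 ⊢
    linarith

lemma contr {n : ℕ} {T : Type*} (P : T → Prop) (g : Fin n → T → ℝ)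
    (t : (Fin n → Bool) → T) (ht : ∀ s, P (t s)) :
    ∃ t' : (Fin n → Bool) → T, (∀ s, P (t' s)) ∧
      ∑ s, ∑ i, sg s i * |g i (t s)| ≤ ∑ s, ∑ i, sg s i * g i (t' s) := by
  classical
  have key : ∀ S : Finset (Fin n), ∃ t' : (Fin n → Bool) → T, (∀ s, P (t' s)) ∧
      ∑ s, ∑ i, sg s i * |g i (t s)| ≤
        ∑ s, ∑ i, sg s i * (if i ∈ S then g i (t' s) else |g i (t' s)|) := by
    intro S
    induction S using Finset.induction_on with
    | empty => exact ⟨t, ht, by simp⟩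
    | insert j S hj ih =>
      obtain ⟨t1, h1, h2⟩ := ih
      obtain ⟨t2, h3, h4⟩ := contr_step P j (g j)
        (fun s t => ∑ i ∈ Finset.univ.erase j, sg s i * (if i ∈ S then g i t else |g i t|))
        (by
          intro s t
          refine Finset.sum_congr rfl fun i hi => ?_
          rw [sg_flip_ne j i (Finset.ne_of_mem_erase hi)]) t1 h1
      refine ⟨t2, h3, h2.trans ?_⟩
      refine le_of_eq_of_le (Finset.sum_congr rfl fun s _ => ?_)
        (h4.trans_eq (Finset.sum_congr rfl fun s _ => ?_))
      · rw [← Finset.sum_erase_add _ _ (Finset.mem_univ j), if_neg hj]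
      · symm
        rw [← Finset.sum_erase_add _ _ (Finset.mem_univ j), if_pos (Finset.mem_insert_self j S)]
        congr 1
        refine Finset.sum_congr rfl fun i hi => ?_
        simp [Finset.mem_insert, Finset.ne_of_mem_erase hi]
  simpa using key Finset.univ

lemma ip_sub {d : ℕ} (w w' x : Fin d → ℝ) : ip w x - ip w' x = ip (w - w') x := by
  simp [ip, sub_mul, Finset.sum_sub_distrib]

lemma twoNorm_nonneg' {d : ℕ} (v : Fin d → ℝ) : 0 ≤ twoNorm v := Real.sqrt_nonneg _

lemma twoNorm_sq {d : ℕ} (v : Fin d → ℝ) : twoNorm v ^ 2 = ∑ i, v i ^ 2 :=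
  Real.sq_sqrt (Finset.sum_nonneg fun i _ => sq_nonneg _)

lemma ip_sq_le {d : ℕ} (u z : Fin d → ℝ) : ip u z ^ 2 ≤ (∑ i, u i ^ 2) * ∑ i, z i ^ 2 :=
  Finset.sum_mul_sq_le_sq_mul_sq _ _ _

lemma ip_le {d : ℕ} (M : ℝ) (u z : Fin d → ℝ) (hu : ∑ i, u i ^ 2 ≤ M) :
    ip u z ≤ Real.sqrt M * twoNorm z := by
  unfold twoNorm
  rw [← Real.sqrt_mul ((Finset.sum_nonneg fun i _ => sq_nonneg (u i)).trans hu)]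
  apply Real.le_sqrt_of_sq_le
  refine (ip_sq_le u z).trans ?_
  gcongr

lemma adv_eq {d : ℕ} (hd : 1 ≤ d) (ε : ℝ) (hε : 0 ≤ ε) (w w' x : Fin d → ℝ) :
    sSup {t : ℝ | ∃ δ : Fin d → ℝ, supNorm δ ≤ ε ∧
            t = (ip w (x + δ) - ip w' (x + δ)) ^ 2}
      = (|ip (w - w') x| + ε * ∑ i, |(w - w') i|) ^ 2 := by
  haveI : Nonempty (Fin d) := ⟨⟨0, hd⟩⟩
  set v := w - w' with hv
  have hadd : ∀ δ, ip v (x + δ) = ip v x + ip v δ := by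
    intro δ; simp [ip, mul_add, Finset.sum_add_distrib]
  apply IsGreatest.csSup_eq
  constructor
  · let c : ℝ := if 0 ≤ ip v x then 1 else -1
    refine ⟨fun j => ε * c * (if 0 ≤ v j then 1 else -1), ?_, ?_⟩
    · refine ciSup_le fun j => ?_
      simp only [c]
      split_ifs <;> simp [abs_of_nonneg hε]
    · rw [ip_sub, ← hv, hadd]
      have h1 : ip v (fun j => ε * c * (if 0 ≤ v j then 1 else -1)) = c * (ε * ∑ i, |v i|) := by
        unfold ip
        rw [Finset.mul_sum, Finset.mul_sum]
        refine Finset.sum_congr rfl fun j _ => ?_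
        beta_reduce
        split_ifs with h
        · rw [abs_of_nonneg h]; ring
        · rw [abs_of_neg (not_le.mp h)]; ring
      rw [h1]
      simp only [c]
      split_ifs with h
      · rw [abs_of_nonneg h]; ring
      · rw [abs_of_neg (not_le.mp h)]; ring
  · rintro t ⟨δ, hδ, rfl⟩
    rw [ip_sub, ← hv, hadd]
    have hδ' : ∀ j, |δ j| ≤ ε := fun j =>
      (le_ciSup (f := fun i => |δ i|) (Set.finite_range _).bddAbove j).trans hδ
    have h2 : |ip v δ| ≤ ε * ∑ i, |v i| := by
      unfold ip
      refine (Finset.abs_sum_le_sum_abs _ _).trans ?_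
      rw [Finset.mul_sum]
      refine Finset.sum_le_sum fun j _ => ?_
      rw [abs_mul, mul_comm]
      exact mul_le_mul_of_nonneg_right (hδ' j) (abs_nonneg _)
    rw [← sq_abs (ip v x + ip v δ)]
    gcongr
    exact (abs_add_le _ _).trans (by linarith)

lemma two_le_p {d : ℕ} (p W : ℝ) (hp : 1 ≤ p) (hW : 0 < W) (w : Fin d → ℝ)
    (hw : pNorm p w ≤ W) :
    ∑ i, w i ^ 2 ≤ W ^ 2 * (if p ≤ 2 then 1 else (d : ℝ) ^ (1 - 2 / p)) := by
  have hp0 : 0 < p := by linarith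
  have hs0 : 0 ≤ ∑ i, |w i| ^ p := Finset.sum_nonneg fun i _ => by positivity
  have hs : ∑ i, |w i| ^ p ≤ W ^ p := by
    unfold pNorm at hw
    have h := Real.rpow_le_rpow (by positivity) hw hp0.le
    rwa [← Real.rpow_mul hs0, one_div, inv_mul_cancel₀ hp0.ne', Real.rpow_one] at h
  split_ifs with h2
  · have hi : ∀ i, |w i| ≤ W := by
      intro i
      have h1 : |w i| ^ p ≤ W ^ p :=
        (Finset.single_le_sum (f := fun i => |w i| ^ p) (fun i _ => by positivity)
          (Finset.mem_univ i)).trans hs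
      exact (Real.rpow_le_rpow_iff (abs_nonneg _) hW.le hp0).mp h1
    have h3 : ∀ i, w i ^ 2 ≤ |w i| ^ p * W ^ (2 - p) := by
      intro i
      have e : w i ^ 2 = |w i| ^ p * |w i| ^ (2 - p) := by
        rw [← Real.rpow_add_of_nonneg (abs_nonneg _) hp0.le (by linarith), ← sq_abs,
          ← Real.rpow_natCast]
        congr 1
        push_cast; ring
      rw [e]
      exact mul_le_mul_of_nonneg_left
        (Real.rpow_le_rpow (abs_nonneg _) (hi i) (by linarith)) (by positivity)
    calc ∑ i, w i ^ 2 ≤ ∑ i, |w i| ^ p * W ^ (2 - p) := Finset.sum_le_sum fun i _ => h3 i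
      _ = (∑ i, |w i| ^ p) * W ^ (2 - p) := by rw [Finset.sum_mul]
      _ ≤ W ^ p * W ^ (2 - p) := by gcongr
      _ = W ^ 2 * 1 := by
        rw [← Real.rpow_add hW, ← Real.rpow_natCast]
        norm_num
  · push Not at h2
    have hq : 1 ≤ p / 2 := by linarith
    have h := Real.rpow_sum_le_const_mul_sum_rpow (s := (Finset.univ : Finset (Fin d)))
      (f := fun i => w i ^ 2) hq
    have e : ∀ i, |w i ^ 2| ^ (p / 2) = |w i| ^ p := by
      intro i
      rw [abs_pow, ← Real.rpow_natCast, ← Real.rpow_mul (abs_nonneg _)]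
      congr 1
      push_cast; ring
    have e2 : ∑ i, |w i ^ 2| = ∑ i, w i ^ 2 :=
      Finset.sum_congr rfl fun i _ => abs_of_nonneg (sq_nonneg _)
    simp only [e, e2, Finset.card_univ, Fintype.card_fin] at h
    have hd0 : (0 : ℝ) ≤ d := Nat.cast_nonneg d
    rw [← Real.rpow_le_rpow_iff (z := p / 2) (Finset.sum_nonneg fun i _ => sq_nonneg _)
      (by positivity) (by linarith)]
    refine h.trans ?_
    rw [Real.mul_rpow (by positivity) (by positivity), ← Real.rpow_mul hd0,
      ← Real.rpow_natCast W, ← Real.rpow_mul hW.le]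
    have a1 : (1 - 2 / p) * (p / 2) = p / 2 - 1 := by field_simp
    have a2 : ((2 : ℕ) : ℝ) * (p / 2) = p := by push_cast; ring
    rw [a1, a2, mul_comm]
    gcongr

lemma main_sel {d n : ℕ} (ε M : ℝ) (hε : 0 ≤ ε) (hM : 0 ≤ M) (x : Fin n → Fin d → ℝ)
    (v : (Fin n → Bool) → Fin d → ℝ) (hv : ∀ s, ∑ i, v s i ^ 2 ≤ M) :
    ∑ s, (ε ^ 2 * (∑ j, |v s j|) ^ 2 * ∑ i, sg s i
        + 2 * ε * (∑ j, |v s j|) * ∑ i, sg s i * |ip (v s) (x i)|)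
      ≤ 2 ^ n * (M * Real.sqrt d * ε * (Real.sqrt d * ε * (Real.sqrt n / 2)
        + 2 * Real.sqrt (∑ i, twoNorm (x i) ^ 2))) := by
  classical
  have hl0 : ∀ s, 0 ≤ ∑ j, |v s j| := fun s => Finset.sum_nonneg fun j _ => abs_nonneg _
  have hl2 : ∀ s, (∑ j, |v s j|) ^ 2 ≤ d * M := by
    intro s
    have h := sq_sum_le_card_mul_sum_sq (s := (Finset.univ : Finset (Fin d)))
      (f := fun j => |v s j|)
    simp only [sq_abs, Finset.card_univ, Fintype.card_fin] at h
    exact h.trans (by gcongr; exact hv s)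
  have hl : ∀ s, ∑ j, |v s j| ≤ Real.sqrt d * Real.sqrt M := by
    intro s
    rw [← Real.sqrt_mul (Nat.cast_nonneg d)]
    exact Real.le_sqrt_of_sq_le (hl2 s)
  -- first part
  have hA1 : ∑ s : Fin n → Bool, |∑ i, sg s i| ≤ 2 ^ n * Real.sqrt n := by
    apply first_moment
    have h := second_moment (n := n) (fun _ => 1)
    simp only [mul_one] at h
    simp only [sq_abs, h]
    simp
  have hA0 : ∑ s : Fin n → Bool, ∑ i, sg s i = 0 := by
    rw [Finset.sum_comm]; simp [sum_sg]
  have hA : ∑ s : Fin n → Bool, max (∑ i, sg s i) 0 ≤ 2 ^ n * (Real.sqrt n / 2) := by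
    have : ∀ s : Fin n → Bool, max (∑ i, sg s i) 0 = (∑ i, sg s i) / 2 + |∑ i, sg s i| / 2 := by
      intro s
      rcases le_total 0 (∑ i, sg s i) with h | h
      · rw [max_eq_left h, abs_of_nonneg h]; ring
      · rw [max_eq_right h, abs_of_nonpos h]; ring
    simp only [this, Finset.sum_add_distrib, ← Finset.sum_div, hA0]
    linarith
  -- second part
  let Y : (Fin n → Bool) → ℝ := fun s => ∑ i, sg s i * |ip (v s) (x i)|
  let u : (Fin n → Bool) → Fin d → ℝ := fun s => if 0 ≤ Y s then v s else 0
  have hu : ∀ s, ∑ i, u s i ^ 2 ≤ M := by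
    intro s
    simp only [u]
    split_ifs
    · exact hv s
    · simpa using hM
  have hY : ∀ s, max (Y s) 0 = ∑ i, sg s i * |ip (u s) (x i)| := by
    intro s
    simp only [u]
    split_ifs with h
    · rw [max_eq_left h]
    · rw [max_eq_right (not_le.mp h).le]
      simp [ip]
  obtain ⟨t, ht, hcon⟩ := contr (fun u : Fin d → ℝ => ∑ i, u i ^ 2 ≤ M)
    (fun i u => ip u (x i)) u hu
  have hz : ∀ s, ∑ i, sg s i * ip (t s) (x i) = ip (t s) (fun j => ∑ i, sg s i * x i j) := by
    intro s
    simp only [ip, Finset.mul_sum]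
    rw [Finset.sum_comm]
    refine Finset.sum_congr rfl fun i _ => Finset.sum_congr rfl fun j _ => by ring
  have hB1 : ∑ s : Fin n → Bool, twoNorm (fun j => ∑ i, sg s i * x i j)
      ≤ 2 ^ n * Real.sqrt (∑ i, twoNorm (x i) ^ 2) := by
    apply first_moment
    simp only [twoNorm_sq]
    rw [Finset.sum_comm]
    simp only [second_moment, ← Finset.mul_sum]
    rw [Finset.sum_comm]
  have hB : ∑ s, max (Y s) 0 ≤ Real.sqrt M * (2 ^ n * Real.sqrt (∑ i, twoNorm (x i) ^ 2)) := by
    simp only [hY]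
    refine hcon.trans ?_
    simp only [hz]
    refine (Finset.sum_le_sum fun s _ => ip_le M _ _ (ht s)).trans ?_
    rw [← Finset.mul_sum]
    gcongr
  have hpt : ∀ s, ε ^ 2 * (∑ j, |v s j|) ^ 2 * ∑ i, sg s i + 2 * ε * (∑ j, |v s j|) * Y s
      ≤ ε ^ 2 * (d * M) * max (∑ i, sg s i) 0
        + 2 * ε * (Real.sqrt d * Real.sqrt M) * max (Y s) 0 := by
    intro s
    have := hl0 s
    apply add_le_add
    · refine (mul_le_mul_of_nonneg_left (le_max_left _ 0) (by positivity)).trans ?_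
      gcongr
      exact hl2 s
    · refine (mul_le_mul_of_nonneg_left (le_max_left _ 0) (by positivity)).trans ?_
      gcongr
      exact hl s
  refine (Finset.sum_le_sum fun s _ => hpt s).trans ?_
  rw [Finset.sum_add_distrib, ← Finset.mul_sum, ← Finset.mul_sum]
  have hdd : Real.sqrt (d : ℝ) * Real.sqrt d = d := Real.mul_self_sqrt (Nat.cast_nonneg d)
  have hMM : Real.sqrt M * Real.sqrt M = M := Real.mul_self_sqrt hM
  calc _ ≤ ε ^ 2 * (d * M) * (2 ^ n * (Real.sqrt n / 2)) + 2 * ε * (Real.sqrt d * Real.sqrt M) *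
        (Real.sqrt M * (2 ^ n * Real.sqrt (∑ i, twoNorm (x i) ^ 2))) := by gcongr
    _ = ε ^ 2 * ((Real.sqrt d * Real.sqrt d) * M) * (2 ^ n * (Real.sqrt n / 2))
        + 2 * ε * Real.sqrt d * (Real.sqrt M * Real.sqrt M) *
        ((2 ^ n * Real.sqrt (∑ i, twoNorm (x i) ^ 2))) := by rw [hdd]; ring
    _ = _ := by rw [hMM]; ring

lemma final_num {d n : ℕ} (hd : 1 ≤ d) (hn : 1 ≤ n) (ε : ℝ) (hε : 0 ≤ ε)
    (x : Fin n → Fin d → ℝ) :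
    Real.sqrt d * ε * (Real.sqrt n / 2) + 2 * Real.sqrt (∑ i, twoNorm (x i) ^ 2) ≤
      Real.sqrt (d : ℝ) * ε + (2 / (n : ℝ)) * ∑ i, twoNorm (x i) +
          Real.sqrt (∑ i, (Real.sqrt (d : ℝ) * ε + 2 * twoNorm (x i)) ^ 2) *
            Real.sqrt (2 * (d : ℝ) * Real.log (6 * (n : ℝ))) := by
  set S := Real.sqrt (∑ i, (Real.sqrt (d : ℝ) * ε + 2 * twoNorm (x i)) ^ 2) with hS
  have hx : ∀ i, 0 ≤ twoNorm (x i) := fun i => twoNorm_nonneg' _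
  have h1 : Real.sqrt d * ε * Real.sqrt n ≤ S := by
    apply Real.le_sqrt_of_sq_le
    rw [mul_pow, Real.sq_sqrt (Nat.cast_nonneg n)]
    have : (Real.sqrt d * ε) ^ 2 * (n : ℝ) = ∑ i : Fin n, (Real.sqrt d * ε) ^ 2 := by
      simp [mul_comm]
    rw [this]
    refine Finset.sum_le_sum fun i _ => ?_
    have := hx i
    gcongr
    linarith
  have h2 : 2 * Real.sqrt (∑ i, twoNorm (x i) ^ 2) ≤ S := by
    apply Real.le_sqrt_of_sq_le
    rw [mul_pow, Real.sq_sqrt (Finset.sum_nonneg fun i _ => sq_nonneg _), Finset.mul_sum]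
    refine Finset.sum_le_sum fun i _ => ?_
    rw [← mul_pow]
    have := hx i
    have : 0 ≤ Real.sqrt d * ε := by positivity
    gcongr
    linarith
  have hd' : (1 : ℝ) ≤ d := by exact_mod_cast hd
  have hn' : (1 : ℝ) ≤ n := by exact_mod_cast hn
  have hlog : (9 : ℝ) / 8 ≤ Real.log (6 * n) := by
    have ha : Real.log 4 ≤ Real.log (6 * n) := Real.log_le_log (by norm_num) (by linarith)
    have hb : Real.log 4 = 2 * Real.log 2 := by
      rw [show (4 : ℝ) = 2 ^ 2 by norm_num, Real.log_pow]; norm_num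
    have := Real.log_two_gt_d9
    linarith
  have h3 : (3 : ℝ) / 2 ≤ Real.sqrt (2 * (d : ℝ) * Real.log (6 * (n : ℝ))) := by
    apply Real.le_sqrt_of_sq_le
    nlinarith
  have h4 : S * (3 / 2) ≤ S * Real.sqrt (2 * (d : ℝ) * Real.log (6 * (n : ℝ))) := by
    have : 0 ≤ S := Real.sqrt_nonneg _
    gcongr
  have h5 : 0 ≤ Real.sqrt d * ε := by positivity
  have h6 : 0 ≤ (2 / (n : ℝ)) * ∑ i, twoNorm (x i) :=
    mul_nonneg (by positivity) (Finset.sum_nonneg fun i _ => hx i)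
  linarith

theorem stmt6 {d n : ℕ} (hd : 1 ≤ d) (hn : 1 ≤ n) (p W ε : ℝ) (hp : 1 ≤ p) (hW : 0 < W)
    (hε : 0 ≤ ε) (x : Fin n → Fin d → ℝ) :
    Esign n (fun σ => sSup {r : ℝ | ∃ w w' : Fin d → ℝ,
        pNorm p w ≤ W ∧ pNorm p w' ≤ W ∧
        r = (1 / (n : ℝ)) * ∑ i, σ i *
          sSup {t : ℝ | ∃ δ : Fin d → ℝ, supNorm δ ≤ ε ∧
            t = (ip w (x i + δ) - ip w' (x i + δ)) ^ 2}}) ≤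
      Esign n (fun σ => sSup {r : ℝ | ∃ w w' : Fin d → ℝ,
        pNorm p w ≤ W ∧ pNorm p w' ≤ W ∧
        r = (1 / (n : ℝ)) * ∑ i, σ i * (ip w (x i) - ip w' (x i)) ^ 2}) +
      4 * W ^ 2 / (n : ℝ) * Real.sqrt (d : ℝ) * ε *
        (Real.sqrt (d : ℝ) * ε + (2 / (n : ℝ)) * ∑ i, twoNorm (x i) +
          Real.sqrt (∑ i, (Real.sqrt (d : ℝ) * ε + 2 * twoNorm (x i)) ^ 2) *
            Real.sqrt (2 * (d : ℝ) * Real.log (6 * (n : ℝ)))) *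
        (if p ≤ 2 then 1 else (d : ℝ) ^ (1 - 2 / p)) := by
  set κ : ℝ := (if p ≤ 2 then 1 else (d : ℝ) ^ (1 - 2 / p)) with hκ
  have hκ0 : 0 ≤ κ := by rw [hκ]; split_ifs <;> positivity
  have hn0 : (0 : ℝ) < n := by exact_mod_cast hn
  simp only [adv_eq hd ε hε]
  simp only [ip_sub]
  have hball : ∀ w w' : Fin d → ℝ, pNorm p w ≤ W → pNorm p w' ≤ W →
      ∑ i, (w - w') i ^ 2 ≤ 4 * W ^ 2 * κ := by
    intro w w' h h'
    have a := two_le_p p W hp hW w h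
    have b := two_le_p p W hp hW w' h'
    rw [← hκ] at a b
    have c : ∑ i, (w - w') i ^ 2 ≤ ∑ i, (2 * w i ^ 2 + 2 * w' i ^ 2) := by
      refine Finset.sum_le_sum fun i _ => ?_
      simp only [Pi.sub_apply]
      nlinarith [sq_nonneg (w i + w' i)]
    rw [Finset.sum_add_distrib, ← Finset.mul_sum, ← Finset.mul_sum] at c
    linarith
  have hM : 0 ≤ 4 * W ^ 2 * κ := by positivity
  have hzero : pNorm p (0 : Fin d → ℝ) ≤ W := by
    have hp0 : 0 < p := by linarith
    simp only [pNorm, Pi.zero_apply, abs_zero, Real.zero_rpow hp0.ne', Finset.sum_const_zero]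
    rw [Real.zero_rpow (by positivity)]
    exact hW.le
  set A : (Fin n → Bool) → Set ℝ := fun s => {r : ℝ | ∃ w w' : Fin d → ℝ,
        pNorm p w ≤ W ∧ pNorm p w' ≤ W ∧
        r = (1 / (n : ℝ)) * ∑ i, sg s i *
          (|ip (w - w') (x i)| + ε * ∑ i, |(w - w') i|) ^ 2} with hA
  set B : (Fin n → Bool) → Set ℝ := fun s => {r : ℝ | ∃ w w' : Fin d → ℝ,
        pNorm p w ≤ W ∧ pNorm p w' ≤ W ∧
        r = (1 / (n : ℝ)) * ∑ i, sg s i * ip (w - w') (x i) ^ 2} with hB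
  have hBdd : ∀ s, BddAbove (B s) := by
    intro s
    refine ⟨(1 / (n : ℝ)) * ∑ i, (4 * W ^ 2 * κ) * ∑ j, x i j ^ 2, ?_⟩
    rintro r ⟨w, w', h, h', rfl⟩
    refine mul_le_mul_of_nonneg_left (Finset.sum_le_sum fun i _ => ?_) (by positivity)
    have h1 := ip_sq_le (w - w') (x i)
    have h2 : (∑ j, (w - w') j ^ 2) * ∑ j, x i j ^ 2 ≤ (4 * W ^ 2 * κ) * ∑ j, x i j ^ 2 :=
      mul_le_mul_of_nonneg_right (hball w w' h h') (Finset.sum_nonneg fun _ _ => sq_nonneg _)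
    have h3 := sq_nonneg (ip (w - w') (x i))
    unfold sg
    split_ifs <;> linarith
  set Q : ℝ := Real.sqrt (d : ℝ) * ε + (2 / (n : ℝ)) * ∑ i, twoNorm (x i) +
          Real.sqrt (∑ i, (Real.sqrt (d : ℝ) * ε + 2 * twoNorm (x i)) ^ 2) *
            Real.sqrt (2 * (d : ℝ) * Real.log (6 * (n : ℝ))) with hQ
  have hmain : ∑ s, sSup (A s) ≤ ∑ s, sSup (B s) +
      2 ^ n * (4 * W ^ 2 / (n : ℝ) * Real.sqrt (d : ℝ) * ε * Q * κ) := by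
    apply le_of_forall_pos_le_add
    intro η hη
    have hK : (0 : ℝ) < 2 ^ n := by positivity
    have hex : ∀ s, ∃ q : (Fin d → ℝ) × (Fin d → ℝ), pNorm p q.1 ≤ W ∧ pNorm p q.2 ≤ W ∧
        sSup (A s) - η / 2 ^ n ≤ (1 / (n : ℝ)) * ∑ i, sg s i *
          (|ip (q.1 - q.2) (x i)| + ε * ∑ i, |(q.1 - q.2) i|) ^ 2 := by
      intro s
      have hne : (A s).Nonempty := ⟨_, 0, 0, hzero, hzero, rfl⟩
      obtain ⟨r, ⟨w, w', h, h', rfl⟩, hr⟩ := exists_lt_of_lt_csSup hne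
        (sub_lt_self (sSup (A s)) (div_pos hη hK))
      exact ⟨(w, w'), h, h', hr.le⟩
    choose q hq1 hq2 hq3 using hex
    let v : (Fin n → Bool) → Fin d → ℝ := fun s => (q s).1 - (q s).2
    have hsel := main_sel ε (4 * W ^ 2 * κ) hε hM x v (fun s => hball _ _ (hq1 s) (hq2 s))
    have hfin := final_num hd hn ε hε x
    rw [← hQ] at hfin
    have hpt : ∀ s, sSup (A s) ≤ sSup (B s) + (1 / (n : ℝ)) *
        (ε ^ 2 * (∑ j, |v s j|) ^ 2 * ∑ i, sg s i
        + 2 * ε * (∑ j, |v s j|) * ∑ i, sg s i * |ip (v s) (x i)|) + η / 2 ^ n := by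
      intro s
      have hb : (1 / (n : ℝ)) * ∑ i, sg s i * ip (v s) (x i) ^ 2 ≤ sSup (B s) :=
        le_csSup (hBdd s) ⟨_, _, hq1 s, hq2 s, rfl⟩
      have h3 := hq3 s
      have e : ∑ i, sg s i * (|ip (v s) (x i)| + ε * ∑ i, |v s i|) ^ 2
          = ∑ i, sg s i * ip (v s) (x i) ^ 2 + (ε ^ 2 * (∑ j, |v s j|) ^ 2 * ∑ i, sg s i
        + 2 * ε * (∑ j, |v s j|) * ∑ i, sg s i * |ip (v s) (x i)|) := by
        generalize (∑ j, |v s j|) = L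
        rw [Finset.mul_sum, Finset.mul_sum, ← Finset.sum_add_distrib, ← Finset.sum_add_distrib]
        refine Finset.sum_congr rfl fun i _ => ?_
        rw [← sq_abs (ip (v s) (x i))]
        ring
      change _ ≤ (1 / (n : ℝ)) * ∑ i, sg s i * (|ip (v s) (x i)| + ε * ∑ i, |v s i|) ^ 2 at h3
      rw [e, mul_add] at h3
      linarith
    have hsum := Finset.sum_le_sum fun s (_ : s ∈ Finset.univ) => hpt s
    rw [Finset.sum_add_distrib, Finset.sum_add_distrib, ← Finset.mul_sum] at hsum
    have hη2 : ∑ _s : Fin n → Bool, η / 2 ^ n = η := by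
      simp only [Finset.sum_const, Finset.card_univ, Fintype.card_pi, Fintype.card_bool,
        Finset.prod_const, Fintype.card_fin, nsmul_eq_mul]
      push_cast
      field_simp
    rw [hη2] at hsum
    have hlast : (1 / (n : ℝ)) * ∑ s, (ε ^ 2 * (∑ j, |v s j|) ^ 2 * ∑ i, sg s i
        + 2 * ε * (∑ j, |v s j|) * ∑ i, sg s i * |ip (v s) (x i)|)
        ≤ 2 ^ n * (4 * W ^ 2 / (n : ℝ) * Real.sqrt (d : ℝ) * ε * Q * κ) := by
      calc _ ≤ (1 / (n : ℝ)) * (2 ^ n * (4 * W ^ 2 * κ * Real.sqrt d * ε * Q)) := by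
            refine mul_le_mul_of_nonneg_left (hsel.trans ?_) (by positivity)
            gcongr
        _ = _ := by ring
    linarith
  have hK : (0 : ℝ) < 2 ^ n := by positivity
  change (∑ s, sSup (A s)) / 2 ^ n ≤ (∑ s, sSup (B s)) / 2 ^ n + _
  rw [div_add' _ _ _ hK.ne']
  gcongr
  linarith
end
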